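/- Let u : Ω → [−1,1] be a minimizer of J(v,Ω) = ∫_Ω (|∇v|^p + (1−v²)^m) dx with u(0) = 0. Then there exist constants δ > 0 and R₀ > 0, depending only on n, p, m, such that for every R ≥ R₀ with B_R ⊆ Ω one has |B_R ∩ {u ≥ 0}| ≥ δ·R^n and |B_R ∩ {u ≤ 0}| ≥ δ·R^n. -/

import Mathlib

open MeasureTheory Metric Set

noncomputable section

/-- `v` is locally Lipschitz at every point of `Ω`. -/
def LocLipOn {n : ℕ} (Ω : Set (EuclideanSpace ℝ (Fin n)))
    (v : EuclideanSpace ℝ (Fin n) → ℝ) : Prop :=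
  ∀ x ∈ Ω, ∃ K : NNReal, ∃ U ∈ nhds x, LipschitzOnWith K v U

/-- The energy `J(v,A) = ∫_A (|∇v|^p + (1-v²)^m) dx`. -/
def Jpm {n : ℕ} (p m : ℝ) (v : EuclideanSpace ℝ (Fin n) → ℝ)
    (A : Set (EuclideanSpace ℝ (Fin n))) : ℝ :=
  ∫ x in A, (‖gradient v x‖ ^ p + (1 - (v x) ^ 2) ^ m)

/-- `u` minimizes `Jpm p m` in `Ω` among `[-1,1]`-valued locally Lipschitz competitors. -/
def IsMinOfJpm {n : ℕ} (p m : ℝ) (Ω : Set (EuclideanSpace ℝ (Fin n)))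
    (u : EuclideanSpace ℝ (Fin n) → ℝ) : Prop :=
  ∀ Ω' : Set (EuclideanSpace ℝ (Fin n)), IsOpen Ω' → Bornology.IsBounded Ω' →
    closure Ω' ⊆ Ω →
    ∀ v : EuclideanSpace ℝ (Fin n) → ℝ,
      (∀ x, v x ∈ Icc (-1 : ℝ) 1) → LocLipOn Ω v →
      (∀ x ∈ Ω \ Ω', v x = u x) →
      Jpm p m u Ω' ≤ Jpm p m v Ω'

theorem LocallyLipschitz.exists_lipschitzWith_of_eq_zero {E : Type*} [NormedAddCommGroup E]
    [ProperSpace E] {f : E → ℝ} (hf : LocallyLipschitz f) {r : ℝ}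
    (h0 : ∀ x, r ≤ ‖x‖ → f x = 0) : ∃ K, LipschitzWith K f := by
  obtain ⟨K, hK⟩ := (hf.locallyLipschitzOn
    (s := closedBall (0 : E) (r + 1))).exists_lipschitzOnWith_of_compact (isCompact_closedBall _ _)
  obtain ⟨M, hM⟩ := (isCompact_closedBall (0 : E) r).exists_bound_of_continuousOn
    hf.continuous.continuousOn
  have hM' : ∀ x, |f x| ≤ max M 0 := fun x => by
    by_cases hx : ‖x‖ ≤ r
    · exact (hM x (by simpa using hx)).trans (le_max_left _ _)
    · rw [h0 x (not_le.1 hx).le]; simp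
  refine ⟨max K (max M 0).toNNReal, LipschitzWith.of_dist_le_mul fun x y => ?_⟩
  have hd := dist_nonneg (x := x) (y := y)
  have key : ∀ x y : E, ‖x‖ ≤ r →
      dist (f x) (f y) ≤ (max K (max M 0).toNNReal : NNReal) * dist x y := fun x y hx => by
    have hd := dist_nonneg (x := x) (y := y)
    by_cases hy : ‖y‖ ≤ r + 1
    · refine (hK.dist_le_mul x (by simp; linarith) y (by simpa using hy)).trans ?_
      gcongr; exact le_max_left _ _
    · push Not at hy
      rw [h0 y (by linarith), Real.dist_eq, sub_zero]
      have h1 : 1 ≤ dist x y := by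
        rw [dist_eq_norm, norm_sub_rev]; linarith [norm_sub_norm_le y x]
      have h2 : max M 0 ≤ ((max K (max M 0).toNNReal : NNReal) : ℝ) := by
        rw [NNReal.coe_max, Real.coe_toNNReal _ (le_max_right _ _)]; exact le_max_right _ _
      nlinarith [hM' x, le_max_right M 0]
  by_cases hx : ‖x‖ ≤ r
  · exact key x y hx
  by_cases hy : ‖y‖ ≤ r
  · rw [dist_comm, dist_comm x]; exact key y x hy
  · rw [h0 x (not_le.1 hx).le, h0 y (not_le.1 hy).le, dist_self]; positivity

section Sobolev

variable {E : Type*} [NormedAddCommGroup E] [NormedSpace ℝ E] [FiniteDimensional ℝ E]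
  [MeasurableSpace E] [BorelSpace E]

theorem LipschitzWith.hasFDerivAt_integral_mul_comp_sub (μ : Measure E) [μ.IsAddHaarMeasure]
    {K : NNReal} {f φ : E → ℝ}
    (hf : LipschitzWith K f) (hφ : Continuous φ) (hφc : HasCompactSupport φ) (x : E) :
    HasFDerivAt (fun x => ∫ t, φ t * f (x - t) ∂μ) (∫ t, φ t • fderiv ℝ f (x - t) ∂μ) x := by
  refine (hasFDerivAt_integral_of_dominated_loc_of_lip (s := univ) (μ := μ)
    (F := fun x t => φ t * f (x - t)) (F' := fun t => φ t • fderiv ℝ f (x - t))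
    (bound := fun t => |φ t| * K) Filter.univ_mem ?_ ?_ ?_ ?_ ?_ ?_).2
  · refine Filter.Eventually.of_forall fun y => Continuous.aestronglyMeasurable ?_
    exact hφ.mul (hf.continuous.comp (by fun_prop))
  · exact (hφ.mul (hf.continuous.comp (by fun_prop))).integrable_of_hasCompactSupport
      (hφc.mul_right)
  · refine (hφ.measurable.smul ((measurable_fderiv ℝ f).comp (by fun_prop))).aestronglyMeasurable
  · refine Filter.Eventually.of_forall fun t => LipschitzWith.lipschitzOnWith ?_
    refine LipschitzWith.of_dist_le_mul fun y z => ?_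
    have := hf.dist_le_mul (y - t) (z - t)
    rw [dist_sub_right] at this
    simp only [Real.coe_nnabs, abs_mul, abs_abs, NNReal.abs_eq, Real.dist_eq, ← mul_sub] at this ⊢
    rw [mul_assoc]
    gcongr
  · exact ((hφ.abs.mul continuous_const)).integrable_of_hasCompactSupport
      (hφc.abs.mul_right)
  · have h : ∀ᵐ t ∂μ, DifferentiableAt ℝ f (x - t) :=
      (quasiMeasurePreserving_sub_left μ x).ae hf.ae_differentiableAt
    filter_upwards [h] with t ht
    have := (ht.hasFDerivAt.comp x ((hasFDerivAt_id x).sub_const t)).const_smul (φ t)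
    simpa only [ContinuousLinearMap.comp_id] using! this

theorem LipschitzWith.integral_norm_fderiv_convolution_le (μ : Measure E) [μ.IsAddHaarMeasure]
    {K : NNReal} {f φ : E → ℝ} (hf : LipschitzWith K f) (hφ : Continuous φ)
    (hφc : HasCompactSupport φ) (hφ0 : ∀ x, 0 ≤ φ x) (hφ1 : ∫ x, φ x ∂μ = 1) :
    ∫⁻ x, ‖fderiv ℝ (fun x => ∫ t, φ t * f (x - t) ∂μ) x‖ₑ ∂μ ≤
      ∫⁻ x, ‖fderiv ℝ f x‖ₑ ∂μ := by
  have hm : Measurable fun x => ‖fderiv ℝ f x‖ₑ := (measurable_fderiv ℝ f).enorm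
  calc _ ≤ ∫⁻ x, ∫⁻ t, ‖φ t‖ₑ * ‖fderiv ℝ f (x - t)‖ₑ ∂μ ∂μ := by
        gcongr with x
        rw [(hf.hasFDerivAt_integral_mul_comp_sub μ hφ hφc x).fderiv]
        refine (enorm_integral_le_lintegral_enorm _).trans ?_
        simp_rw [enorm_smul]; rfl
    _ = ∫⁻ t, ∫⁻ x, ‖φ t‖ₑ * ‖fderiv ℝ f (x - t)‖ₑ ∂μ ∂μ := by
        rw [lintegral_lintegral_swap]
        have : Measurable φ := hφ.measurable
        refine Measurable.aemeasurable ?_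
        refine Measurable.mul (by fun_prop) (hm.comp (by fun_prop))
    _ = ∫⁻ t, ‖φ t‖ₑ * ∫⁻ x, ‖fderiv ℝ f x‖ₑ ∂μ ∂μ := by
        congr 1 with t
        rw [lintegral_const_mul' _ _ enorm_ne_top,
          lintegral_sub_right_eq_self (fun x => ‖fderiv ℝ f x‖ₑ)]
    _ = ∫⁻ x, ‖fderiv ℝ f x‖ₑ ∂μ := by
        rw [lintegral_mul_const _ hφ.measurable.enorm]
        have : ∫⁻ t, ‖φ t‖ₑ ∂μ = 1 := by
          simp_rw [fun t => Real.enorm_of_nonneg (hφ0 t)]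
          rw [← ofReal_integral_eq_lintegral_ofReal
            (hφ.integrable_of_hasCompactSupport hφc) (Filter.Eventually.of_forall hφ0), hφ1]
          simp
        rw [this, one_mul]

theorem LipschitzWith.pow_mul_measureReal_pow_le (μ : Measure E) [μ.IsAddHaarMeasure]
    (hE : 2 ≤ Module.finrank ℝ E) :
    ∃ C > (0 : ℝ), ∀ (K : NNReal) (f : E → ℝ), LipschitzWith K f → HasCompactSupport f →
      ∀ c > (0 : ℝ), ∀ S : Set E, (∀ x ∈ S, c ≤ f x) →
        c ^ Module.finrank ℝ E * μ.real S ^ (Module.finrank ℝ E - 1) ≤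
          (C * ∫ x, ‖fderiv ℝ f x‖ ∂μ) ^ Module.finrank ℝ E := by
  set d := Module.finrank ℝ E with hd
  have hd1 : (1 : ℝ) < d := by exact_mod_cast hE
  set q : ℝ := Real.conjExponent d with hq
  have hconj : Real.HolderConjugate d q := Real.HolderConjugate.conjExponent hd1
  have hq0 : 0 < q := hconj.symm.pos
  have hqd : q * ((d - 1 : ℕ) : ℝ) = d := by
    rw [Nat.cast_sub (by omega), hq, Real.conjExponent, Nat.cast_one]
    field_simp [show (d : ℝ) - 1 ≠ 0 by linarith]
  set C₀ : NNReal := lintegralPowLePowLIntegralFDerivConst μ q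
  have hd0 : d ≠ 0 := by omega
  refine ⟨2 * ((C₀ : ℝ) ^ ((d - 1 : ℕ) : ℝ) + 1), by positivity, fun K f hf hfc c hc S hS => ?_⟩
  have hSsub : S ⊆ tsupport f := fun x hx => subset_tsupport f (by
    have := hS x hx; simp only [Function.mem_support]; linarith)
  have hSfin : μ S ≠ ⊤ := measure_ne_top_of_subset hSsub (hfc.isCompact.measure_lt_top.ne)
  -- a mollifier at scale `c / (2 (K + 1))`
  let φ : ContDiffBump (0 : E) := ⟨c / (4 * (K + 1)), c / (2 * (K + 1)), by positivity, by
    gcongr; norm_num⟩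
  set ψ := φ.normed μ with hψ
  have hψc : Continuous ψ := φ.continuous_normed
  have hψs : HasCompactSupport ψ := φ.hasCompactSupport_normed
  set g : E → ℝ := fun x => ∫ t, ψ t * f (x - t) ∂μ with hg
  have hgconv : g = convolution ψ f (ContinuousLinearMap.lsmul ℝ ℝ) μ := by
    ext x; simp [hg, convolution_def]
  have hg1 : ContDiff ℝ 1 g := by
    rw [hgconv]
    exact hψs.contDiff_convolution_left _ φ.contDiff_normed hf.continuous.locallyIntegrable
  have hgc : HasCompactSupport g := by
    rw [hgconv]; exact hψs.convolution _ hfc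
  have hgS : ∀ x ∈ S, c / 2 ≤ g x := fun x hx => by
    have h1 : dist (g x) (f x) ≤ c / 2 := by
      rw [hgconv]
      refine φ.dist_normed_convolution_le hf.continuous.aestronglyMeasurable fun y hy => ?_
      refine (hf.dist_le_mul y x).trans ?_
      rw [mem_ball] at hy
      have h2 : φ.rOut = c / (2 * (K + 1)) := rfl
      rw [h2] at hy
      calc (K : ℝ) * dist y x ≤ (K + 1) * (c / (2 * (K + 1))) := by gcongr; linarith
        _ = c / 2 := by field_simp
    rw [Real.dist_eq] at h1
    linarith [hS x hx, (abs_le.1 h1).1]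
  have hsob := lintegral_pow_le_pow_lintegral_fderiv μ hg1 hgc hconj
  have hmono : ∫⁻ x, ‖fderiv ℝ g x‖ₑ ∂μ ≤ ∫⁻ x, ‖fderiv ℝ f x‖ₑ ∂μ :=
    hf.integral_norm_fderiv_convolution_le μ hψc hψs φ.nonneg_normed φ.integral_normed
  have hfin : ∫⁻ x, ‖fderiv ℝ f x‖ₑ ∂μ = ENNReal.ofReal (∫ x, ‖fderiv ℝ f x‖ ∂μ) := by
    rw [ofReal_integral_eq_lintegral_ofReal _ (Filter.Eventually.of_forall fun _ => norm_nonneg _)]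
    · simp_rw [ofReal_norm]
    · refine Integrable.norm ?_
      rw [← integrableOn_iff_integrable_of_support_subset
        ((support_fderiv_subset ℝ) : _ ⊆ tsupport f)]
      refine Measure.integrableOn_of_bounded (M := K) hfc.isCompact.measure_lt_top.ne
        (measurable_fderiv ℝ f).aestronglyMeasurable
        (Filter.Eventually.of_forall fun x => norm_fderiv_le_of_lipschitz ℝ hf)
  set I := ∫ x, ‖fderiv ℝ f x‖ ∂μ
  have hI : 0 ≤ I := integral_nonneg fun _ => norm_nonneg _
  have hlow : ENNReal.ofReal (c / 2) ^ q * μ S ≤ ∫⁻ x, ‖g x‖ₑ ^ q ∂μ := by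
    refine le_trans ?_ (mul_meas_ge_le_lintegral (hg1.continuous.measurable.enorm.pow_const q)
      (ENNReal.ofReal (c / 2) ^ q))
    gcongr
    intro x hx
    simp only [mem_ofPred_eq]
    gcongr
    rw [Real.enorm_eq_ofReal_abs]
    exact ENNReal.ofReal_le_ofReal ((hgS x hx).trans (le_abs_self _))
  have hreal : (c / 2) ^ q * μ.real S ≤ C₀ * I ^ q := by
    have h1 := hlow.trans hsob
    have h2 : ENNReal.ofReal (c / 2) ^ q * μ S ≤ C₀ * ENNReal.ofReal I ^ q :=
      h1.trans (by gcongr; exact hmono.trans hfin.le)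
    rw [ENNReal.ofReal_rpow_of_nonneg (by positivity) hq0.le,
      ENNReal.ofReal_rpow_of_nonneg hI hq0.le] at h2
    have h3 := ENNReal.toReal_mono (by finiteness) h2
    rwa [ENNReal.toReal_mul, ENNReal.toReal_mul, ENNReal.toReal_ofReal (by positivity),
      ENNReal.toReal_ofReal (by positivity)] at h3
  have hpow : ∀ y : ℝ, 0 ≤ y → (y ^ q) ^ (d - 1) = y ^ d := fun y hy => by
    rw [← Real.rpow_natCast, ← Real.rpow_mul hy, hqd, Real.rpow_natCast]
  have h4 := pow_le_pow_left₀ (by positivity) hreal (d - 1)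
  rw [mul_pow, mul_pow, hpow _ (by positivity), hpow _ hI, div_pow, div_mul_eq_mul_div,
    div_le_iff₀ (by positivity)] at h4
  refine h4.trans ?_
  rw [mul_pow, mul_pow, Real.rpow_natCast]
  have h5 : (C₀ : ℝ) ^ (d - 1) ≤ ((C₀ : ℝ) ^ (d - 1) + 1) ^ d :=
    (le_add_of_nonneg_right zero_le_one).trans
      (le_self_pow₀ (le_add_of_nonneg_left (by positivity)) hd0)
  calc _ ≤ ((C₀ : ℝ) ^ (d - 1) + 1) ^ d * I ^ d * 2 ^ d := by gcongr
    _ = _ := by ring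

end Sobolev

theorem LipschitzWith.integral_fderiv_apply_self {n : ℕ} {K : NNReal}
    {g : EuclideanSpace ℝ (Fin n) → ℝ} (hg : LipschitzWith K g) (hgc : HasCompactSupport g) :
    ∫ x, fderiv ℝ g x x = -(n * ∫ x, g x) := by
  have hint : ∀ i : Fin n, Integrable fun x : EuclideanSpace ℝ (Fin n) =>
      x i * fderiv ℝ g x (EuclideanSpace.single i 1) := fun i => by
    obtain ⟨M, hM⟩ := hgc.isCompact.exists_bound_of_continuousOn
      (f := fun x : EuclideanSpace ℝ (Fin n) => x i) (by fun_prop)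
    rw [← integrableOn_iff_integrable_of_support_subset (s := tsupport g)]
    · refine Measure.integrableOn_of_bounded (M := M * K) hgc.isCompact.measure_lt_top.ne ?_ ?_
      · exact ((by fun_prop : Measurable fun x : EuclideanSpace ℝ (Fin n) => x i).mul
          (measurable_fderiv_apply_const ℝ g _)).aestronglyMeasurable
      · refine (ae_restrict_iff' (isClosed_tsupport g).measurableSet).2
          (Filter.Eventually.of_forall fun x hx => ?_)
        rw [norm_mul]
        have h1 := (fderiv ℝ g x).le_opNorm (EuclideanSpace.single i 1)
        rw [PiLp.norm_single, norm_one, mul_one] at h1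
        exact mul_le_mul (hM x hx) (h1.trans (norm_fderiv_le_of_lipschitz ℝ hg)) (norm_nonneg _)
          ((norm_nonneg _).trans (hM x hx))
    · intro x hx
      have : fderiv ℝ g x ≠ 0 := by
        rintro h; simp [h] at hx
      exact support_fderiv_subset ℝ this
  have hcoord : ∀ i : Fin n, ∫ x : EuclideanSpace ℝ (Fin n),
      x i * fderiv ℝ g x (EuclideanSpace.single i 1) = - ∫ x, g x := fun i => by
    have hf := (EuclideanSpace.proj (𝕜 := ℝ) i : EuclideanSpace ℝ (Fin n) →L[ℝ] ℝ).lipschitz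
    have h := LipschitzWith.integral_lineDeriv_mul_eq (μ := volume) hf hg hgc
      (EuclideanSpace.single i 1)
    have h1 : ∀ x : EuclideanSpace ℝ (Fin n), lineDeriv ℝ
        (EuclideanSpace.proj (𝕜 := ℝ) i : EuclideanSpace ℝ (Fin n) →L[ℝ] ℝ) x
          (EuclideanSpace.single i 1) = 1 := fun x => by
      rw [(ContinuousLinearMap.differentiableAt _).lineDeriv_eq_fderiv,
        ContinuousLinearMap.fderiv]
      simp
    simp_rw [h1, one_mul] at h
    rw [h, ← integral_neg]
    refine integral_congr_ae ?_
    filter_upwards [hg.ae_differentiableAt] with x hx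
    rw [hx.lineDeriv_eq_fderiv]
    simp; ring
  have hsum : ∀ x : EuclideanSpace ℝ (Fin n), fderiv ℝ g x x =
      ∑ i, x i * fderiv ℝ g x (EuclideanSpace.single i 1) := fun x => by
    conv_lhs => rw [congrArg (fderiv ℝ g x) ((EuclideanSpace.basisFun (Fin n) ℝ).sum_repr x).symm]
    simp only [map_sum, map_smul, smul_eq_mul, EuclideanSpace.basisFun_repr,
      EuclideanSpace.basisFun_apply]
  simp_rw [hsum]
  rw [integral_finsetSum _ fun i _ => hint i]
  simp [hcoord]

/-- The double-well potential `(1-u²)^m` in the variable `s = 1 + u`. -/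
def doubleWell (m s : ℝ) : ℝ := (s * (2 - s)) ^ m

theorem continuous_doubleWell {m : ℝ} (hm : 0 < m) : Continuous (doubleWell m) :=
  (by fun_prop : Continuous fun s : ℝ => s * (2 - s)).rpow_const fun _ => Or.inr hm.le

theorem doubleWell_nonneg {m s : ℝ} (h0 : 0 ≤ s) (h2 : s ≤ 2) : 0 ≤ doubleWell m s :=
  Real.rpow_nonneg (mul_nonneg h0 (by linarith)) _

theorem doubleWell_le_one {m s : ℝ} (hm : 0 ≤ m) (h0 : 0 ≤ s) (h2 : s ≤ 2) :
    doubleWell m s ≤ 1 :=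
  Real.rpow_le_one (mul_nonneg h0 (by linarith)) (by nlinarith [sq_nonneg (s - 1)]) hm

/-- The energy density of `w`, with the wells shifted to `0` and `2`. -/
def energyDensity {n : ℕ} (p m : ℝ) (w : EuclideanSpace ℝ (Fin n) → ℝ)
    (x : EuclideanSpace ℝ (Fin n)) : ℝ := ‖fderiv ℝ w x‖ ^ p + doubleWell m (w x)

/-- `w` does not lose energy when cut from above by a Lipschitz barrier `h`
that is at least `2` outside a ball contained in `B_ρ`. -/
def MinimizesBelowBarriers {n : ℕ} (p m ρ : ℝ) (w : EuclideanSpace ℝ (Fin n) → ℝ) : Prop :=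
  ∀ r ≤ ρ, ∀ (K : NNReal) (h : EuclideanSpace ℝ (Fin n) → ℝ), LipschitzWith K h →
    (∀ x, 0 ≤ h x) → (∀ x, r ≤ ‖x‖ → 2 ≤ h x) →
    ∫ x in {x | h x < w x}, energyDensity p m w x ≤ ∫ x in {x | h x < w x}, energyDensity p m h x

theorem integrableOn_energyDensity {n : ℕ} {p m : ℝ} (hp : 0 < p) (hm : 0 < m) {K : NNReal}
    {w : EuclideanSpace ℝ (Fin n) → ℝ} (hw : LipschitzWith K w)
    {s : Set (EuclideanSpace ℝ (Fin n))} (hsm : MeasurableSet s) (hs : volume s ≠ ⊤)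
    (hw0 : ∀ x ∈ s, w x ∈ Icc (0 : ℝ) 2) :
    IntegrableOn (energyDensity p m w) s := by
  refine Measure.integrableOn_of_bounded (M := (K : ℝ) ^ p + 1) hs ?_
    (ae_restrict_of_forall_mem hsm fun x hx => ?_)
  · exact (((measurable_fderiv ℝ w).norm.pow_const p).add
      ((continuous_doubleWell hm).comp hw.continuous).measurable).aestronglyMeasurable
  · have h1 := doubleWell_nonneg (m := m) (hw0 x hx).1 (hw0 x hx).2
    rw [energyDensity, Real.norm_of_nonneg (by positivity)]
    refine add_le_add ?_ (doubleWell_le_one hm.le (hw0 x hx).1 (hw0 x hx).2)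
    gcongr
    exact norm_fderiv_le_of_lipschitz ℝ hw

theorem LocLipOn.locallyLipschitzOn {n : ℕ} {Ω s : Set (EuclideanSpace ℝ (Fin n))}
    {v : EuclideanSpace ℝ (Fin n) → ℝ} (hv : LocLipOn Ω v) (hs : s ⊆ Ω) :
    LocallyLipschitzOn s v := fun x hx => by
  obtain ⟨K, U, hU, hK⟩ := hv x (hs hx)
  exact ⟨K, U, mem_nhdsWithin_of_mem_nhds hU, hK⟩

theorem norm_gradient_eq {n : ℕ} (v : EuclideanSpace ℝ (Fin n) → ℝ)
    (x : EuclideanSpace ℝ (Fin n)) : ‖gradient v x‖ = ‖fderiv ℝ v x‖ := by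
  simp [gradient]

theorem fderiv_eq_of_le_of_eq {E : Type*} [NormedAddCommGroup E] [NormedSpace ℝ E] {f g : E → ℝ}
    {x : E} (hf : DifferentiableAt ℝ f x) (hg : DifferentiableAt ℝ g x) (hle : ∀ y, f y ≤ g y)
    (hx : f x = g x) : fderiv ℝ f x = fderiv ℝ g x := by
  have hmin : IsLocalMin (fun y => g y - f y) x :=
    Filter.Eventually.of_forall fun y => by simp only [hx, sub_self]; linarith [hle y]
  have := hmin.fderiv_eq_zero
  rw [fderiv_fun_sub hg hf, sub_eq_zero] at this
  exact this.symm

theorem IsMinOfJpm.exists_lipschitz {n : ℕ} {p m : ℝ} (hp : 0 < p) (hm : 0 < m)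
    {Ω : Set (EuclideanSpace ℝ (Fin n))}
    {u : EuclideanSpace ℝ (Fin n) → ℝ} (hu : ∀ x, u x ∈ Icc (-1 : ℝ) 1) (hL : LocLipOn Ω u)
    (hmin : IsMinOfJpm p m Ω u) {ρ : ℝ} (hρ : closedBall 0 ρ ⊆ Ω) :
    ∃ K w, LipschitzWith K w ∧ (∀ x, w x ∈ Icc (0 : ℝ) 2) ∧ (∀ x, ‖x‖ ≤ ρ → w x = 1 + u x) ∧
      MinimizesBelowBarriers p m ρ w := by
  obtain ⟨K, hK⟩ := (hL.locallyLipschitzOn hρ).exists_lipschitzOnWith_of_compact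
    (isCompact_closedBall _ _)
  obtain ⟨g, hg, hug⟩ := hK.extend_real
  have hw1 : LipschitzWith K fun x => max (min (1 + g x) 2) 0 := by
    refine ((LipschitzWith.min_const ?_ 2).max_const 0)
    simpa using (LipschitzWith.const (1 : ℝ)).add hg
  have hwu : ∀ x, ‖x‖ ≤ ρ → max (min (1 + g x) 2) 0 = 1 + u x := fun x hx => by
    rw [← hug (by simpa using hx : x ∈ closedBall 0 ρ), min_eq_left (by linarith [(hu x).2]),
      max_eq_left (by linarith [(hu x).1])]
  have hw2 : ∀ x, max (min (1 + g x) 2) 0 ∈ Icc (0 : ℝ) 2 := fun x =>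
    ⟨le_max_right _ _, max_le (min_le_right _ _) zero_le_two⟩
  set w : EuclideanSpace ℝ (Fin n) → ℝ := fun x => max (min (1 + g x) 2) 0 with hw
  refine ⟨K, w, hw1, hw2, hwu, fun r hr L h hh h0 h2 => ?_⟩
  have hsub : {x | h x < w x} ⊆ ball 0 r := fun x hx => by
    rw [mem_ball_zero_iff]
    by_contra hxr
    exact absurd hx (not_lt.2 ((hw2 x).2.trans (h2 x (not_lt.1 hxr))))
  have hmeas : MeasurableSet {x | h x < w x} :=
    measurableSet_lt hh.continuous.measurable hw1.continuous.measurable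
  have hclos : closure (ball (0 : EuclideanSpace ℝ (Fin n)) r) ⊆ Ω :=
    closure_ball_subset_closedBall.trans ((closedBall_subset_closedBall hr).trans hρ)
  have key := hmin (ball 0 r) isOpen_ball isBounded_ball hclos (fun x => min (u x) (h x - 1))
    (fun x => ⟨le_min (hu x).1 (by linarith [h0 x]), (min_le_left _ _).trans (hu x).2⟩) ?_ ?_
  · set v : EuclideanSpace ℝ (Fin n) → ℝ := fun x => min (w x) (h x) with hv
    have hvL : LipschitzWith (max K L) v := hw1.min hh
    have hv2 : ∀ x, v x ∈ Icc (0 : ℝ) 2 := fun x =>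
      ⟨le_min (hw2 x).1 (h0 x), (min_le_left _ _).trans (hw2 x).2⟩
    have hfin : volume (ball (0 : EuclideanSpace ℝ (Fin n)) r) ≠ ⊤ := measure_ball_lt_top.ne
    have e1 : Jpm p m u (ball 0 r) = ∫ x in ball 0 r, energyDensity p m w x := by
      refine setIntegral_congr_fun measurableSet_ball fun x hx => ?_
      have hev : w =ᶠ[nhds x] fun y => 1 + u y := by
        filter_upwards [isOpen_ball.mem_nhds hx] with y hy
        exact hwu y ((mem_ball_zero_iff.1 hy).le.trans hr)
      simp only [energyDensity, norm_gradient_eq, hev.fderiv_eq, hev.eq_of_nhds, doubleWell,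
        fderiv_const_add]
      congr 2; ring
    have e2 : Jpm p m (fun x => min (u x) (h x - 1)) (ball 0 r) =
        ∫ x in ball 0 r, energyDensity p m v x := by
      refine setIntegral_congr_fun measurableSet_ball fun x hx => ?_
      have hev : v =ᶠ[nhds x] fun y => 1 + min (u y) (h y - 1) := by
        filter_upwards [isOpen_ball.mem_nhds hx] with y hy
        have hwy : w y = 1 + u y := hwu y ((mem_ball_zero_iff.1 hy).le.trans hr)
        rw [← min_add_add_left, add_sub_cancel, ← hwy]
      simp only [energyDensity, norm_gradient_eq, hev.fderiv_eq, hev.eq_of_nhds, doubleWell,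
        fderiv_const_add]
      congr 2; ring
    rw [e1, e2, ← integral_inter_add_sdiff hmeas (integrableOn_energyDensity hp hm hw1 measurableSet_ball hfin
      fun x _ => hw2 x),
      ← integral_inter_add_sdiff hmeas (integrableOn_energyDensity hp hm hvL measurableSet_ball hfin
      fun x _ => hv2 x),
      inter_eq_right.2 hsub] at key
    have e3 : ∫ x in ball 0 r \ {x | h x < w x}, energyDensity p m w x =
        ∫ x in ball 0 r \ {x | h x < w x}, energyDensity p m v x := by
      refine setIntegral_congr_ae (measurableSet_ball.diff hmeas) ?_
      filter_upwards [hw1.ae_differentiableAt, hvL.ae_differentiableAt] with x hx1 hx2 hx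
      have hvw : v x = w x := min_eq_left (not_lt.1 hx.2)
      rw [energyDensity, energyDensity, hvw,
        fderiv_eq_of_le_of_eq hx2 hx1 (fun y => min_le_left _ _) hvw]
    have e4 : ∫ x in {x | h x < w x}, energyDensity p m v x =
        ∫ x in {x | h x < w x}, energyDensity p m h x := by
      refine setIntegral_congr_fun hmeas fun x hx => ?_
      have hev : v =ᶠ[nhds x] h := by
        filter_upwards [(isOpen_lt hh.continuous hw1.continuous).mem_nhds hx] with y hy
        exact min_eq_right (le_of_lt hy)
      simp only [energyDensity, hev.fderiv_eq, hev.eq_of_nhds]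
    linarith
  · intro x hx
    obtain ⟨K₁, U, hU, hK₁⟩ := hL x hx
    refine ⟨max K₁ L, U, hU, lipschitzOnWith_iff_restrict.2 ?_⟩
    refine (lipschitzOnWith_iff_restrict.1 hK₁).min ?_
    refine LipschitzWith.of_dist_le_mul fun y z => ?_
    simpa [Subtype.dist_eq] using hh.dist_le_mul y z
  · intro x hx
    have : r ≤ ‖x‖ := by simpa using hx.2
    exact min_eq_left (by linarith [h2 x this, (hu x).2])

theorem IsMinOfJpm.neg {n : ℕ} {p m : ℝ} {Ω : Set (EuclideanSpace ℝ (Fin n))}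
    {u : EuclideanSpace ℝ (Fin n) → ℝ} (h : IsMinOfJpm p m Ω u) :
    IsMinOfJpm p m Ω fun x => -u x := fun Ω' h1 h2 h3 v hv hvL hvu => by
  have hJ : ∀ f : EuclideanSpace ℝ (Fin n) → ℝ, Jpm p m (fun x => -f x) Ω' = Jpm p m f Ω' :=
    fun f => by simp [Jpm, norm_gradient_eq, fderiv_fun_neg]
  rw [hJ, ← hJ v]
  refine h Ω' h1 h2 h3 _ (fun x => ⟨by linarith [(hv x).2], by linarith [(hv x).1]⟩) ?_
    fun x hx => by rw [hvu x hx, neg_neg]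
  intro x hx
  obtain ⟨K, U, hU, hK⟩ := hvL x hx
  exact ⟨K, U, hU, hK.neg⟩

theorem le_geometric_of_pow_le {k : ℕ} (hk : k ≠ 0) {B : ℝ} (hB : 0 < B) {V : ℕ → ℝ}
    (hV : ∀ j, 0 ≤ V j) (hstep : ∀ j, V (j + 1) ^ k ≤ (B * 2 ^ j * V j) ^ (k + 1))
    (h0 : V 0 ≤ (B ^ (k + 1) * 2 ^ ((k + 1) * k))⁻¹) (j : ℕ) :
    V j ≤ (B ^ (k + 1) * 2 ^ ((k + 1) * k))⁻¹ * ((2 ^ (k + 1) : ℝ)⁻¹) ^ j := by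
  induction j with
  | zero => simpa using h0
  | succ j ih =>
    set μ := (B ^ (k + 1) * 2 ^ ((k + 1) * k))⁻¹ with hμ
    have hμ0 : 0 < μ := by positivity
    refine le_of_pow_le_pow_left₀ hk (by positivity) ((hstep j).trans ?_)
    calc (B * 2 ^ j * V j) ^ (k + 1)
        ≤ (B * 2 ^ j * (μ * ((2 ^ (k + 1) : ℝ)⁻¹) ^ j)) ^ (k + 1) := by
          have := hV j
          gcongr
      _ = (μ * B ^ (k + 1)) * (μ ^ k * ((2 ^ k : ℝ)⁻¹ ^ j) ^ (k + 1)) := by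
          have : (2 : ℝ) ^ j * ((2 ^ (k + 1) : ℝ)⁻¹) ^ j = (2 ^ k : ℝ)⁻¹ ^ j := by
            rw [← mul_pow]; congr 1; rw [pow_succ]; field_simp
          rw [← this]; ring
      _ = (2 ^ ((k + 1) * k))⁻¹ * (μ ^ k * ((2 ^ k : ℝ)⁻¹ ^ j) ^ (k + 1)) := by
          congr 1; rw [hμ]; field_simp
      _ = (μ * ((2 ^ (k + 1) : ℝ)⁻¹) ^ (j + 1)) ^ k := by
          rw [mul_pow]
          simp only [inv_pow, ← pow_mul]
          rw [mul_left_comm, ← mul_inv, ← pow_add]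
          congr 3; ring


theorem MinimizesBelowBarriers.mono {n : ℕ} {p m ρ r : ℝ} {w : EuclideanSpace ℝ (Fin n) → ℝ}
    (h : MinimizesBelowBarriers p m ρ w) (hr : r ≤ ρ) : MinimizesBelowBarriers p m r w :=
  fun s hs => h s (hs.trans hr)

theorem LipschitzWith.norm_fderiv_max_sub_le {n : ℕ} {K L : NNReal} {w h : EuclideanSpace ℝ (Fin n) → ℝ}
    (hw : LipschitzWith K w) (hh : LipschitzWith L h) :
    ∀ᵐ x, ‖fderiv ℝ (fun x => max (w x - h x) 0) x‖ ≤
      {x | h x < w x}.indicator (fun x => ‖fderiv ℝ w x‖ + L) x := by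
  filter_upwards [hw.ae_differentiableAt, hh.ae_differentiableAt,
    ((hw.sub hh).max_const 0).ae_differentiableAt] with x hx1 hx2 hx3
  by_cases hx : h x < w x
  · rw [indicator_of_mem (by exact hx)]
    have hev : (fun x => max (w x - h x) 0) =ᶠ[nhds x] fun x => w x - h x := by
      filter_upwards [(isOpen_lt hh.continuous hw.continuous).mem_nhds hx] with y hy
      exact max_eq_left (sub_nonneg.2 (le_of_lt hy))
    rw [hev.fderiv_eq, fderiv_fun_sub hx1 hx2]
    exact (_root_.norm_sub_le _ _).trans (by gcongr; exact norm_fderiv_le_of_lipschitz ℝ hh)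
  · rw [indicator_of_notMem (by exact hx)]
    rw [← fderiv_eq_of_le_of_eq (differentiableAt_const 0) hx3 (fun y => le_max_right _ _)
      (by rw [max_eq_right]; linarith)]
    simp

theorem MinimizesBelowBarriers.exists_le_measureReal {n : ℕ} (hn : 2 ≤ n) {p m : ℝ} (hp : 1 < p)
    (hm : 0 < m) :
    ∃ c > (0 : ℝ), ∀ (K : NNReal) (w : EuclideanSpace ℝ (Fin n) → ℝ), LipschitzWith K w →
      (∀ x, w x ∈ Icc (0 : ℝ) 2) → MinimizesBelowBarriers p m 1 w → w 0 = 1 →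
      c ≤ volume.real ({x | 1 / 2 < w x} ∩ ball 0 1) := by
  obtain ⟨C, hC, hsob⟩ := LipschitzWith.pow_mul_measureReal_pow_le
    (volume : Measure (EuclideanSpace ℝ (Fin n))) (by simpa using hn)
  rw [finrank_euclideanSpace_fin] at hsob
  obtain ⟨k, rfl⟩ : ∃ k, n = k + 1 := ⟨n - 1, by omega⟩
  have hk : k ≠ 0 := by omega
  set M : ℝ := 2 ^ p + 4 with hM
  set B : ℝ := 8 * (C * M) with hB
  have hM0 : 0 < M := by positivity
  have hB0 : 0 < B := by positivity
  refine ⟨(B ^ (k + 1) * 2 ^ ((k + 1) * k))⁻¹, by positivity, fun K w hw hw2 hmin hw0 => ?_⟩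
  let h : ℝ → EuclideanSpace ℝ (Fin (k + 1)) → ℝ := fun t x => 1 / 2 + t + 2 * ‖x‖
  have hL : ∀ t, LipschitzWith 2 (h t) := fun t => by
    refine LipschitzWith.of_dist_le_mul fun x y => ?_
    have := abs_norm_sub_norm_le x y
    simp only [h, dist_eq_norm, add_sub_add_left_eq_sub, ← mul_sub]
    simpa using this
  let A : ℝ → Set (EuclideanSpace ℝ (Fin (k + 1))) := fun t => {x | h t x < w x}
  have hAopen : ∀ t, IsOpen (A t) := fun t => isOpen_lt (hL t).continuous hw.continuous
  have hAsub : ∀ t, 0 ≤ t → A t ⊆ {x | 1 / 2 < w x} ∩ ball 0 1 := fun t ht x hx => by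
    have h1 : 1 / 2 + t + 2 * ‖x‖ < w x := hx
    have := norm_nonneg x
    refine ⟨by simp only [mem_ofPred_eq]; linarith, ?_⟩
    rw [mem_ball_zero_iff]
    by_contra hcon
    linarith [(hw2 x).2]
  have hfin : ∀ t, 0 ≤ t → volume (A t) ≠ ⊤ := fun t ht =>
    measure_ne_top_of_subset ((hAsub t ht).trans inter_subset_right) measure_ball_lt_top.ne
  have hgrad : ∀ t, 0 ≤ t → ∫ x, ‖fderiv ℝ (fun x => max (w x - h t x) 0) x‖ ≤
      M * volume.real (A t) := fun t ht => by
    have hint := integrableOn_energyDensity (p := p) (m := m) (by linarith) hm hw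
      (hAopen t).measurableSet (hfin t ht)
      fun x _ => hw2 x
    have hcon : ∀ c : ℝ, IntegrableOn (fun _ => c) (A t) := fun c =>
      integrableOn_const (hfin t ht)
    have h1 : IntegrableOn (fun x => ‖fderiv ℝ w x‖) (A t) :=
      Measure.integrableOn_of_bounded (M := K) (hfin t ht)
        (measurable_fderiv ℝ w).norm.aestronglyMeasurable
        (Filter.Eventually.of_forall fun x => by
          rw [norm_norm]; exact norm_fderiv_le_of_lipschitz ℝ hw)
    calc _ ≤ ∫ x, (A t).indicator (fun x => ‖fderiv ℝ w x‖ + (2 : NNReal)) x := by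
          refine integral_mono_of_nonneg (Filter.Eventually.of_forall fun _ => norm_nonneg _) ?_
            (hw.norm_fderiv_max_sub_le (hL t))
          exact (integrable_indicator_iff (hAopen t).measurableSet).2 (h1.add (hcon _))
      _ = ∫ x in A t, (‖fderiv ℝ w x‖ + (2 : NNReal)) :=
          integral_indicator (hAopen t).measurableSet
      _ ≤ ∫ x in A t, (energyDensity p m w x + 3) := by
          refine setIntegral_mono (h1.add (hcon _)) (hint.add (hcon _)) fun x => ?_
          have h2 := doubleWell_nonneg (m := m) (hw2 x).1 (hw2 x).2
          have h3 : ‖fderiv ℝ w x‖ ≤ ‖fderiv ℝ w x‖ ^ p + 1 := by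
            rcases le_total ‖fderiv ℝ w x‖ 1 with h4 | h4
            · have : 0 ≤ ‖fderiv ℝ w x‖ ^ p := by positivity
              linarith
            · linarith [Real.self_le_rpow_of_one_le h4 hp.le]
          simp only [energyDensity, NNReal.coe_ofNat]
          linarith
      _ = (∫ x in A t, energyDensity p m w x) + 3 * volume.real (A t) := by
          rw [integral_add hint (hcon _), setIntegral_const, smul_eq_mul, mul_comm (volume.real _)]
      _ ≤ (∫ x in A t, energyDensity p m (h t) x) + 3 * volume.real (A t) := by
          refine add_le_add ?_ le_rfl
          refine hmin 1 le_rfl 2 (h t) (hL t) (fun x => by positivity) fun x hx => ?_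
          simp only [h]; linarith
      _ ≤ (2 ^ p + 1) * volume.real (A t) + 3 * volume.real (A t) := by
          refine add_le_add ((Real.le_norm_self _).trans ?_) le_rfl
          refine norm_setIntegral_le_of_norm_le_const (hfin t ht).lt_top fun x hx => ?_
          have h5 : h t x ≤ 2 := (le_of_lt hx).trans (hw2 x).2
          have h6 : 0 ≤ h t x := by positivity
          have h7 := doubleWell_nonneg (m := m) h6 h5
          rw [energyDensity, Real.norm_of_nonneg (by positivity)]
          refine add_le_add ?_ (doubleWell_le_one hm.le h6 h5)
          gcongr
          exact norm_fderiv_le_of_lipschitz ℝ (hL t)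
      _ = _ := by rw [hM]; ring
  have hiter : ∀ s t, 0 ≤ s → s < t → (t - s) ^ (k + 1) * volume.real (A t) ^ k ≤
      (C * (M * volume.real (A s))) ^ (k + 1) := fun s t hs hst => by
    refine (hsob _ _ ((hw.sub (hL s)).max_const 0) ?_ (t - s) (sub_pos.2 hst) (A t)
      fun x hx => ?_).trans ?_
    · refine HasCompactSupport.intro (isCompact_closedBall 0 1) fun x hx => ?_
      refine max_eq_right (sub_nonpos.2 (not_lt.1 fun hlt => hx ?_))
      exact ball_subset_closedBall (hAsub s hs hlt).2
    · have : h t x < w x := hx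
      refine le_trans ?_ (le_max_left _ _)
      simp only [h] at this ⊢; linarith
    · have : 0 ≤ ∫ x, ‖fderiv ℝ (fun x => max (w x - h s x) 0) x‖ :=
        integral_nonneg fun _ => norm_nonneg _
      gcongr
      exact hgrad s hs
  have hpos : 0 < volume.real (A (1 / 4)) := by
    refine ENNReal.toReal_pos ((hAopen _).measure_pos _ ⟨0, ?_⟩).ne' (hfin _ (by norm_num))
    simp only [A, h, mem_ofPred_eq, hw0, norm_zero]; norm_num
  by_contra! hcon
  let τ : ℕ → ℝ := fun j => 1 / 4 * (1 - (2 ^ j)⁻¹)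
  have hinv : ∀ j : ℕ, ((2 : ℝ) ^ j)⁻¹ ≤ 1 := fun j => inv_le_one_of_one_le₀ (one_le_pow₀ one_le_two)
  have hτ0 : ∀ j, 0 ≤ τ j := fun j => by
    have := hinv j
    simp only [τ]; linarith
  have hτ1 : ∀ j, τ (j + 1) - τ j = (2 ^ j)⁻¹ / 8 := fun j => by
    simp only [τ, pow_succ]; field_simp; ring
  have hgeo := le_geometric_of_pow_le hk hB0 (V := fun j => volume.real (A (τ j)))
    (fun j => measureReal_nonneg) (fun j => by
      have := hiter (τ j) (τ (j + 1)) (hτ0 j) (sub_pos.1 (by rw [hτ1]; positivity))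
      rw [hτ1] at this
      calc volume.real (A (τ (j + 1))) ^ k =
          (8 * 2 ^ j) ^ (k + 1) * (((2 ^ j)⁻¹ / 8) ^ (k + 1) * volume.real (A (τ (j + 1))) ^ k) := by
            rw [← mul_assoc, ← mul_pow]; field_simp; simp
        _ ≤ (8 * 2 ^ j) ^ (k + 1) * (C * (M * volume.real (A (τ j)))) ^ (k + 1) := by gcongr
        _ = _ := by rw [← mul_pow, hB]; ring)
    ((measureReal_mono (hAsub _ (hτ0 0)) (measure_ne_top_of_subset inter_subset_right
      measure_ball_lt_top.ne)).trans hcon.le)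
  have hlim : Filter.Tendsto (fun j : ℕ => (B ^ (k + 1) * 2 ^ ((k + 1) * k))⁻¹ *
      ((2 ^ (k + 1) : ℝ)⁻¹) ^ j) Filter.atTop (nhds 0) := by
    rw [← mul_zero (B ^ (k + 1) * 2 ^ ((k + 1) * k))⁻¹]
    refine (tendsto_pow_atTop_nhds_zero_of_lt_one (by positivity) ?_).const_mul _
    exact inv_lt_one_of_one_lt₀ (one_lt_pow₀ one_lt_two (by omega))
  refine absurd (ge_of_tendsto' hlim fun j => le_trans ?_ (hgeo j)) (not_le.2 hpos)
  refine measureReal_mono (fun x hx => ?_) (hfin _ (hτ0 j))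
  have h8 : h (1 / 4) x < w x := hx
  have h9 : (0 : ℝ) ≤ (2 ^ j)⁻¹ := by positivity
  simp only [A, h, τ, mem_ofPred_eq] at h8 ⊢
  linarith

theorem add_one_pow_sub_pow_le {n : ℕ} {r : ℝ} (hr : 1 ≤ r) :
    (r + 1) ^ n - r ^ n ≤ n * 2 ^ n * r ^ (n - 1) := by
  have h := (le_abs_self _).trans (abs_pow_sub_pow_le (r + 1) r n)
  rw [add_sub_cancel_left, abs_one, one_mul, abs_of_nonneg (by linarith : 0 ≤ r + 1),
    abs_of_nonneg (by linarith : 0 ≤ r), max_eq_left (by linarith)] at h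
  calc _ ≤ _ := h
    _ ≤ n * (2 * r) ^ (n - 1) := by gcongr; linarith
    _ = n * 2 ^ (n - 1) * r ^ (n - 1) := by rw [mul_pow, mul_assoc]
    _ ≤ _ := by gcongr <;> [exact one_le_two; exact n.sub_le 1]

theorem MinimizesBelowBarriers.exists_measureReal_le (n : ℕ) {p m : ℝ} (hp : 1 < p)
    (hm : 0 < m) :
    ∃ C > (0 : ℝ), ∀ (K : NNReal) (w : EuclideanSpace ℝ (Fin n) → ℝ), LipschitzWith K w →
      (∀ x, w x ∈ Icc (0 : ℝ) 2) → ∀ r, 1 ≤ r → MinimizesBelowBarriers p m (r + 1) w →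
      volume.real ({x | 1 / 2 < w x ∧ w x < 1} ∩ ball 0 r) ≤ C * r ^ (n - 1) := by
  set ω := volume.real (ball (0 : EuclideanSpace ℝ (Fin n)) 1) with hω
  have hω0 : 0 < ω := ENNReal.toReal_pos (measure_ball_pos _ _ one_pos).ne' measure_ball_lt_top.ne
  refine ⟨((3 / 4 : ℝ) ^ m)⁻¹ * ((2 ^ p + 1) * ((n + 1) * 2 ^ n * ω)), by positivity,
    fun K w hw hw2 r hr hmin => ?_⟩
  have hr0 : 0 ≤ r := by linarith
  let h : EuclideanSpace ℝ (Fin n) → ℝ := fun x => 2 * max (‖x‖ - r) 0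
  have hL : LipschitzWith 2 h := by
    refine LipschitzWith.of_dist_le_mul fun x y => ?_
    have h1 := abs_norm_sub_norm_le x y
    have h2 := abs_max_sub_max_le_abs (‖x‖ - r) (‖y‖ - r) 0
    rw [sub_sub_sub_cancel_right] at h2
    rw [dist_eq_norm x y, Real.dist_eq, ← mul_sub, abs_mul, abs_two, NNReal.coe_ofNat]
    linarith
  have hh0 : ∀ x, 0 ≤ h x := fun x => mul_nonneg zero_le_two (le_max_right _ _)
  set A : Set (EuclideanSpace ℝ (Fin n)) := {x | h x < w x} with hA
  have hAm : MeasurableSet A :=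
    measurableSet_lt hL.continuous.measurable hw.continuous.measurable
  have h2 : ∀ x, r + 1 ≤ ‖x‖ → 2 ≤ h x := fun x hx => by
    have := le_max_left (‖x‖ - r) 0
    simp only [h]; linarith
  have hAsub : A ⊆ ball 0 (r + 1) := fun x hx => by
    rw [mem_ball_zero_iff]
    by_contra hcon
    exact absurd hx (not_lt.2 ((hw2 x).2.trans (h2 x (not_lt.1 hcon))))
  have hAfin : volume A ≠ ⊤ := measure_ne_top_of_subset hAsub measure_ball_lt_top.ne
  set S := {x | 1 / 2 < w x ∧ w x < 1} ∩ ball 0 r with hS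
  have hSm : MeasurableSet S :=
    ((measurableSet_lt measurable_const hw.continuous.measurable).inter
      (measurableSet_lt hw.continuous.measurable measurable_const)).inter measurableSet_ball
  have hSA : S ⊆ A := fun x hx => by
    have h3 := mem_ball_zero_iff.1 hx.2
    have : h x = 0 := by simp only [h]; rw [max_eq_right (by linarith), mul_zero]
    have h4 := hx.1.1
    simp only [hA, mem_ofPred_eq, this]; linarith
  have hint := integrableOn_energyDensity (p := p) (m := m) (by linarith) hm hw hAm hAfin
    fun x _ => hw2 x
  have hlow : (3 / 4 : ℝ) ^ m * volume.real S ≤ ∫ x in A, energyDensity p m w x := by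
    refine le_trans ?_ (setIntegral_mono_set hint ?_ hSA.eventuallyLE)
    · rw [mul_comm, ← smul_eq_mul, ← setIntegral_const]
      refine setIntegral_mono_on (integrableOn_const (measure_ne_top_of_subset hSA hAfin))
        (hint.mono_set hSA) hSm fun x hx => ?_
      have h5 : (3 / 4 : ℝ) ^ m ≤ doubleWell m (w x) := by
        refine Real.rpow_le_rpow (by norm_num) ?_ hm.le
        nlinarith [hx.1.1, hx.1.2]
      have : 0 ≤ ‖fderiv ℝ w x‖ ^ p := by positivity
      rw [energyDensity]; linarith
    · refine Filter.Eventually.of_forall fun x => ?_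
      have := doubleWell_nonneg (m := m) (hw2 x).1 (hw2 x).2
      simp only [energyDensity, Pi.zero_apply]; positivity
  have hup : ∫ x in A, energyDensity p m h x ≤
      (2 ^ p + 1) * volume.real (ball (0 : EuclideanSpace ℝ (Fin n)) (r + 1) \ ball 0 r) := by
    have h6 : ∫ x in A, energyDensity p m h x = ∫ x in A \ ball 0 r, energyDensity p m h x := by
      refine setIntegral_eq_of_subset_of_forall_sdiff_eq_zero hAm sdiff_subset fun x hx => ?_
      have hxr : x ∈ ball 0 r := by simpa [hx.1] using hx.2
      have hev : h =ᶠ[nhds x] fun _ => 0 := by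
        filter_upwards [isOpen_ball.mem_nhds hxr] with y hy
        have := mem_ball_zero_iff.1 hy
        simp only [h]; rw [max_eq_right (by linarith), mul_zero]
      rw [energyDensity, hev.fderiv_eq, hev.eq_of_nhds]
      simp [doubleWell, Real.zero_rpow hm.ne', Real.zero_rpow (by linarith : p ≠ 0)]
    rw [h6]
    refine (Real.le_norm_self _).trans ((norm_setIntegral_le_of_norm_le_const (C := 2 ^ p + 1)
      (measure_ne_top_of_subset sdiff_subset hAfin).lt_top fun x hx => ?_).trans ?_)
    · have h5 : h x ≤ 2 := (le_of_lt hx.1).trans (hw2 x).2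
      have h7 := doubleWell_nonneg (m := m) (hh0 x) h5
      rw [energyDensity, Real.norm_of_nonneg (by positivity)]
      refine add_le_add ?_ (doubleWell_le_one hm.le (hh0 x) h5)
      gcongr
      exact norm_fderiv_le_of_lipschitz ℝ hL
    · gcongr
      exact measure_ne_top_of_subset sdiff_subset measure_ball_lt_top.ne
  have hball : ∀ s, 0 < s → volume.real (ball (0 : EuclideanSpace ℝ (Fin n)) s) = s ^ n * ω :=
    fun s hs => by
      rw [measureReal_def, Measure.addHaar_ball_of_pos _ _ hs, ENNReal.toReal_mul,
        ENNReal.toReal_ofReal (by positivity), finrank_euclideanSpace_fin, hω, measureReal_def]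
  have hvol : volume.real (ball (0 : EuclideanSpace ℝ (Fin n)) (r + 1) \ ball 0 r) ≤
      (n + 1) * 2 ^ n * ω * r ^ (n - 1) := by
    rw [measureReal_sdiff (ball_subset_ball (by linarith)) measurableSet_ball,
      hball (r + 1) (by linarith), hball r (by linarith), ← sub_mul]
    have := add_one_pow_sub_pow_le (n := n) hr
    calc _ ≤ (n * 2 ^ n * r ^ (n - 1)) * ω := by gcongr
      _ ≤ ((n + 1) * 2 ^ n * r ^ (n - 1)) * ω := by gcongr; linarith
      _ = _ := by ring
  have hmn := hmin (r + 1) le_rfl 2 h hL hh0 h2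
  have h34 : (0 : ℝ) < (3 / 4) ^ m := by positivity
  rw [mul_assoc, mul_assoc, ← mul_assoc, mul_assoc, le_inv_mul_iff₀ h34]
  calc _ ≤ _ := hlow.trans (hmn.trans hup)
    _ ≤ (2 ^ p + 1) * ((n + 1) * 2 ^ n * ω * r ^ (n - 1)) := by gcongr
    _ = _ := by ring

theorem mul_rpow_le_rpow_add_rpow {p : ℝ} (hp : 1 < p) {m y s : ℝ} (hy : 0 ≤ y) (hs : 0 ≤ s) :
    s ^ (m * (p - 1) / p) * y ≤ y ^ p + s ^ m := by
  have hpq := Real.HolderConjugate.conjExponent hp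
  have h1 := Real.young_inequality_of_nonneg hy (Real.rpow_nonneg hs (m * (p - 1) / p)) hpq
  have hq := hpq.symm.lt
  rw [← Real.rpow_mul hs, show m * (p - 1) / p * p.conjExponent = m by
    rw [Real.conjExponent]; field_simp [sub_ne_zero.2 hp.ne']] at h1
  have h2 : y ^ p / p ≤ y ^ p := div_le_self (by positivity) hp.le
  have h3 : s ^ m / p.conjExponent ≤ s ^ m := div_le_self (by positivity) hq.le
  linarith

theorem mul_mul_rpow_sub_one_le {p : ℝ} (hp : 1 < p) {ε y z : ℝ} (hε : 0 < ε) (hy : 0 ≤ y)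
    (hz : 0 ≤ z) :
    p * (y * z ^ (p - 1)) ≤ ε * y ^ p + (p - 1) * ε ^ (-(p - 1)⁻¹) * z ^ p := by
  have hpq := Real.HolderConjugate.conjExponent hp
  have hp1 : 0 < p - 1 := by linarith
  have hp0 : 0 < p := by linarith
  have h1 := Real.young_inequality_of_nonneg (a := ε ^ p⁻¹ * y) (b := ε ^ (-p⁻¹) * z ^ (p - 1))
    (by positivity) (by positivity) hpq
  have h2 : ε ^ p⁻¹ * y * (ε ^ (-p⁻¹) * z ^ (p - 1)) = y * z ^ (p - 1) := by
    rw [Real.rpow_neg hε.le]; field_simp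
  rw [h2, Real.mul_rpow (by positivity) hy, Real.mul_rpow (by positivity) (by positivity),
    ← Real.rpow_mul hε.le, ← Real.rpow_mul hε.le, ← Real.rpow_mul hz, inv_mul_cancel₀ hp0.ne',
    Real.rpow_one, show (p - 1) * p.conjExponent = p by
      rw [Real.conjExponent]; field_simp,
    show -p⁻¹ * p.conjExponent = -(p - 1)⁻¹ by rw [Real.conjExponent]; field_simp] at h1
  have h3 := mul_le_mul_of_nonneg_left h1 hp0.le
  refine h3.trans (le_of_eq ?_)
  rw [Real.conjExponent]; field_simp

theorem rpow_sub_one_mul_sub_le_doubleWell_sub {m h w : ℝ} (hm : 1 ≤ m) (hh : 0 < h) (hhw : h ≤ w)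
    (hw : w ≤ 1 / 2) : h ^ (m - 1) * (w - h) ≤ doubleWell m w - doubleWell m h := by
  set A := w * (2 - w) with hA
  set B := h * (2 - h) with hB
  have hBh : h ≤ B := by nlinarith
  have hAB : w - h ≤ A - B := by nlinarith
  have hB0 : 0 < B := by linarith
  have hA0 : 0 < A := by linarith
  have h1 := one_add_mul_self_le_rpow_one_add (s := (A - B) / B)
    (by rw [le_div_iff₀ hB0]; linarith) hm
  have h2 : 1 + (A - B) / B = A / B := by field_simp; ring
  rw [h2, Real.div_rpow hA0.le hB0.le, le_div_iff₀ (by positivity)] at h1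
  have h3 : B ^ m = B ^ (m - 1) * B := by
    rw [Real.rpow_sub_one hB0.ne']; field_simp
  have h4 : (1 + m * ((A - B) / B)) * B ^ m = B ^ m + m * (B ^ (m - 1) * (A - B)) := by
    rw [add_mul, one_mul]; congr 1; rw [h3]; field_simp
  have h5 : h ^ (m - 1) * (w - h) ≤ B ^ (m - 1) * (A - B) := by
    have : h ^ (m - 1) ≤ B ^ (m - 1) := Real.rpow_le_rpow hh.le hBh (by linarith)
    have : 0 ≤ w - h := by linarith
    gcongr
  have h6 : 0 ≤ B ^ (m - 1) * (A - B) := mul_nonneg (by positivity) (by linarith)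
  have h7 : B ^ (m - 1) * (A - B) ≤ m * (B ^ (m - 1) * (A - B)) := le_mul_of_one_le_left h6 hm
  simp only [doubleWell]
  linarith

theorem half_mul_rpow_le_doubleWell_sub {m h w : ℝ} (hm : 1 ≤ m) (hh : 0 ≤ h) (hhw : 2 * h ≤ w)
    (hw : w ≤ 1 / 2) : w ^ m / 2 ≤ doubleWell m w - doubleWell m h := by
  have h1 : doubleWell m h ≤ w ^ m :=
    Real.rpow_le_rpow (by nlinarith) (by nlinarith) (by linarith)
  have h2 : (3 / 2 * w) ^ m ≤ doubleWell m w :=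
    Real.rpow_le_rpow (by linarith) (by nlinarith) (by linarith)
  have h3 : (3 / 2 : ℝ) ≤ (3 / 2) ^ m := Real.self_le_rpow_of_one_le (by norm_num) hm
  rw [Real.mul_rpow (by norm_num) (by linarith)] at h2
  have h4 : 0 ≤ w ^ m := Real.rpow_nonneg (by linarith) _
  nlinarith

theorem doubleWell_le_mul_rpow {m h : ℝ} (hm : 0 ≤ m) (hh : 0 < h) (h2 : h ≤ 2) :
    doubleWell m h ≤ 2 ^ (m + 1) * h ^ (m - 1) := by
  have h1 : doubleWell m h ≤ (2 * h) ^ m :=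
    Real.rpow_le_rpow (by nlinarith) (by nlinarith) hm
  rw [Real.mul_rpow zero_le_two hh.le] at h1
  have h3 : h ^ m = h ^ (m - 1) * h := by rw [Real.rpow_sub_one hh.ne']; field_simp
  rw [Real.rpow_add_one two_ne_zero]
  have h4 : (0 : ℝ) < 2 ^ m * h ^ (m - 1) := by positivity
  rw [h3] at h1
  nlinarith

/-- The excess of the energy density at a point with value `w`, slope `y` and slope `s` along the
calibrating field, over that of a barrier with value `h`, slope `z` and field divergence `D`. -/
def calibratedExcess (p m y z s h w D : ℝ) : ℝ :=
  y ^ p + (p - 1) * z ^ p - p * s + doubleWell m w - doubleWell m h - D * (w - h)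

theorem exists_le_calibratedExcess {p m : ℝ} (hp : 1 < p) (hm : 1 ≤ m) :
    ∃ η > (0 : ℝ), ∃ B > (0 : ℝ), ∀ y z s h w D : ℝ, 0 ≤ y → 0 ≤ z → 0 < h → h < w → w ≤ 2 →
      z ^ p ≤ η * h ^ m → 0 ≤ D → D ≤ η * h ^ (m - 1) → |s| ≤ y * z ^ (p - 1) →
      (w ≤ 1 / 2 → 0 ≤ calibratedExcess p m y z s h w D) ∧
      (w ≤ 1 / 2 → 2 * h < w → w ^ (m * (p - 1) / p) * y + h ^ (m * (p - 1) / p) * z ≤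
        12 * calibratedExcess p m y z s h w D) ∧
      (1 / 2 < w → h ^ (m * (p - 1) / p) * z ≤
        12 * (calibratedExcess p m y z s h w D + B * h ^ (m - 1))) := by
  set c : ℝ := (p - 1) * (1 / 2) ^ (-(p - 1)⁻¹) with hc
  have hp1 : 0 < p - 1 := by linarith
  have hc0 : 0 < c := by positivity
  set η : ℝ := 1 / (4 * (c + 1)) with hη
  have hη0 : 0 < η := by positivity
  have hηc : η * (c + 1) = 1 / 4 := by rw [hη]; field_simp
  have hη1 : η ≤ 1 := by nlinarith
  refine ⟨η, hη0, 2 ^ (m + 1) + 3, by positivity,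
    fun y z s h w D hy hz hh hhw hw2 hzh hD0 hD hs => ?_⟩
  have hs' := (abs_le.1 hs).2
  have hy1 := mul_mul_rpow_sub_one_le hp one_pos hy hz
  rw [Real.one_rpow, one_mul, mul_one] at hy1
  have hy2 := mul_mul_rpow_sub_one_le hp (half_pos one_pos) hy hz
  rw [← hc] at hy2
  have hps : p * s ≤ p * (y * z ^ (p - 1)) := by gcongr
  have hhm : 0 < h ^ (m - 1) := by positivity
  have hhm' : 0 < h ^ m := by positivity
  have hmm : h ^ m = h ^ (m - 1) * h := by rw [Real.rpow_sub_one hh.ne']; field_simp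
  have hzp : 0 ≤ z ^ p := by positivity
  have hw0 : 0 < w := hh.trans hhw
  have hzz := mul_rpow_le_rpow_add_rpow hp (m := m) hz hh.le
  have hyy := mul_rpow_le_rpow_add_rpow hp (m := m) hy hw0.le
  have hηh : η * h ^ m ≤ h ^ m := by nlinarith
  have hηh' : η * h ^ (m - 1) ≤ h ^ (m - 1) := by nlinarith
  have hDw : D * (w - h) ≤ η * h ^ (m - 1) * (w - h) := by
    have : 0 ≤ w - h := by linarith
    gcongr
  unfold calibratedExcess
  refine ⟨fun hw => ?_, fun hw h2 => ?_, fun hw => ?_⟩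
  · have h3 := rpow_sub_one_mul_sub_le_doubleWell_sub hm hh hhw.le hw
    have h4 : η * h ^ (m - 1) * (w - h) ≤ h ^ (m - 1) * (w - h) := by
      have : 0 ≤ w - h := by linarith
      gcongr
    linarith
  · have h3 := half_mul_rpow_le_doubleWell_sub hm hh.le h2.le hw
    have h4 : h ^ m ≤ w ^ m := Real.rpow_le_rpow hh.le hhw.le (by linarith)
    have h5 : h ^ (m - 1) * (w - h) ≤ w ^ m := by
      have e : w ^ m = w ^ (m - 1) * w := by rw [Real.rpow_sub_one hw0.ne']; field_simp
      rw [e]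
      have : h ^ (m - 1) ≤ w ^ (m - 1) := Real.rpow_le_rpow hh.le hhw.le (by linarith)
      have : 0 ≤ w - h := by linarith
      gcongr
      linarith
    have h6 : η * h ^ (m - 1) * (w - h) ≤ η * w ^ m := by
      rw [mul_assoc]; gcongr
    have h7 : c * z ^ p ≤ c * η * w ^ m := by
      calc c * z ^ p ≤ c * (η * h ^ m) := by gcongr
        _ ≤ c * (η * w ^ m) := by gcongr
        _ = _ := by ring
    have h8 : c * η * w ^ m + η * w ^ m = w ^ m / 4 := by
      linear_combination w ^ m * hηc
    have h9 : 0 ≤ (p - 1) * z ^ p := by positivity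
    have h10 : 0 ≤ y ^ p := by positivity
    linarith
  · have h3 := doubleWell_le_mul_rpow (m := m) (by linarith) hh (by linarith)
    have h4 := doubleWell_nonneg (m := m) hw0.le hw2
    have h5 : h ^ m ≤ 2 * h ^ (m - 1) := by nlinarith
    have h6 : η * h ^ (m - 1) * (w - h) ≤ h ^ (m - 1) * 2 := by
      have : 0 ≤ w - h := by linarith
      gcongr
      linarith
    linarith

theorem LipschitzWith.integrableOn_and_integral_mul_fderiv_sub_add_eq_zero {n : ℕ} {K L M : NNReal}
    {w h f : EuclideanSpace ℝ (Fin n) → ℝ} (hw : LipschitzWith K w) (hh : LipschitzWith L h)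
    (hf : LipschitzWith M f) (hf0 : ∀ x, 0 ≤ f x) {ρ : ℝ} (hsub : {x | h x < w x} ⊆ ball 0 ρ) :
    IntegrableOn (fun x => f x * (fderiv ℝ w x x - fderiv ℝ h x x) +
      (w x - h x) * (n * f x + fderiv ℝ f x x)) {x | h x < w x} ∧
    ∫ x in {x | h x < w x}, (f x * (fderiv ℝ w x x - fderiv ℝ h x x) +
      (w x - h x) * (n * f x + fderiv ℝ f x x)) = 0 := by
  set A : Set (EuclideanSpace ℝ (Fin n)) := {x | h x < w x} with hA
  have hAo : IsOpen A := isOpen_lt hh.continuous hw.continuous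
  have hAfin : volume A ≠ ⊤ := measure_ne_top_of_subset hsub measure_ball_lt_top.ne
  let g : EuclideanSpace ℝ (Fin n) → ℝ := fun x => f x * max (w x - h x) 0
  have hg0 : ∀ x, x ∉ A → g x = 0 := fun x hx => by
    simp only [g]; rw [max_eq_right (sub_nonpos.2 (not_lt.1 hx)), mul_zero]
  have hgρ : ∀ x, ρ ≤ ‖x‖ → g x = 0 := fun x hx =>
    hg0 x fun hxA => absurd (mem_ball_zero_iff.1 (hsub hxA)) (not_lt.2 hx)
  obtain ⟨J, hg⟩ : ∃ J, LipschitzWith J g := by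
    refine LocallyLipschitz.exists_lipschitzWith_of_eq_zero ?_ hgρ
    exact (contDiff_fst.mul contDiff_snd : ContDiff ℝ 1 fun p : ℝ × ℝ => p.1 * p.2)
      |>.locallyLipschitz.comp
        (hf.locallyLipschitz.prodMk ((hw.sub hh).max_const 0).locallyLipschitz)
  have hgc : HasCompactSupport g :=
    HasCompactSupport.intro (isCompact_closedBall 0 ρ) fun x hx => hgρ x (by
      rw [mem_closedBall_zero_iff, not_le] at hx; exact hx.le)
  have hoff : ∀ᵐ x, x ∉ A → fderiv ℝ g x x = 0 := by
    filter_upwards [hg.ae_differentiableAt] with x hx hxA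
    rw [← fderiv_eq_of_le_of_eq (differentiableAt_const 0) hx
      (fun y => mul_nonneg (hf0 y) (le_max_right _ _)) (hg0 x hxA).symm]
    simp
  have hon : ∀ᵐ x, x ∈ A → f x * (fderiv ℝ w x x - fderiv ℝ h x x) +
      (w x - h x) * (n * f x + fderiv ℝ f x x) = fderiv ℝ g x x + n * g x := by
    filter_upwards [hw.ae_differentiableAt, hh.ae_differentiableAt, hf.ae_differentiableAt]
      with x hx1 hx2 hx3 hxA
    have hev : g =ᶠ[nhds x] fun x => f x * (w x - h x) := by
      filter_upwards [hAo.mem_nhds hxA] with y hy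
      simp only [g]; rw [max_eq_left (sub_nonneg.2 (le_of_lt hy))]
    rw [hev.fderiv_eq, hev.eq_of_nhds, fderiv_fun_mul hx3 (hx1.fun_sub hx2),
      fderiv_fun_sub hx1 hx2]
    simp only [add_apply, smul_apply, sub_apply, smul_eq_mul]
    ring
  have hgi : IntegrableOn g A := (hg.continuous.integrable_of_hasCompactSupport hgc).integrableOn
  have hdi : IntegrableOn (fun x => fderiv ℝ g x x) A := by
    refine Measure.integrableOn_of_bounded (M := J * ρ) hAfin ?_
      (ae_restrict_of_forall_mem hAo.measurableSet fun x hx => ?_)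
    · exact isBoundedBilinearMap_apply.continuous.comp_aestronglyMeasurable
        ((measurable_fderiv ℝ g).aestronglyMeasurable.prodMk aestronglyMeasurable_id)
    · refine (ContinuousLinearMap.le_opNorm _ _).trans ?_
      have := (mem_ball_zero_iff.1 (hsub hx)).le
      gcongr
      exact norm_fderiv_le_of_lipschitz ℝ hg
  have hon' := (ae_restrict_iff' hAo.measurableSet).2 hon
  refine ⟨(hdi.add (hgi.const_mul (n : ℝ))).congr (hon'.mono fun x hx => hx.symm), ?_⟩
  rw [integral_congr_ae hon', integral_add hdi (hgi.const_mul _), integral_const_mul,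
    setIntegral_eq_integral_of_forall_compl_eq_zero hg0,
    setIntegral_eq_integral_of_ae_compl_eq_zero hoff, hg.integral_fderiv_apply_self hgc]
  ring

theorem exists_integral_norm_fderiv_truncation_le (n : ℕ) {p m : ℝ} (hp : 1 < p) (hm : 1 ≤ m) :
    ∃ η > (0 : ℝ), ∃ C > (0 : ℝ), ∀ (K L M : NNReal) (w h f : EuclideanSpace ℝ (Fin n) → ℝ)
      (ρ c : ℝ), LipschitzWith K w → LipschitzWith L h → LipschitzWith M f →
      (∀ x, w x ∈ Icc (0 : ℝ) 2) → (∀ x, 0 < h x) → (∀ x, ρ ≤ ‖x‖ → 2 ≤ h x) → (∀ x, 0 ≤ f x) →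
      MinimizesBelowBarriers p m ρ w →
      (∀ x, h x < w x → ‖fderiv ℝ h x‖ ^ p ≤ η * h x ^ m ∧
        0 ≤ p * (c * (n * f x + fderiv ℝ f x x)) ∧
        p * (c * (n * f x + fderiv ℝ f x x)) ≤ η * h x ^ (m - 1) ∧
        |c * f x| * ‖x‖ = ‖fderiv ℝ h x‖ ^ (p - 1) ∧
        c * f x * fderiv ℝ h x x = ‖fderiv ℝ h x‖ ^ p) →
      (∃ J, LipschitzWith J fun x => max (min (w x) (1 / 2) ^ (1 + m * (p - 1) / p) -
        (2 * h x) ^ (1 + m * (p - 1) / p)) 0) ∧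
      ∫ x, ‖fderiv ℝ (fun x => max (min (w x) (1 / 2) ^ (1 + m * (p - 1) / p) -
        (2 * h x) ^ (1 + m * (p - 1) / p)) 0) x‖ ≤
        C * ∫ x in {x | h x < w x} ∩ {x | 1 / 2 < w x}, h x ^ (m - 1) := by
  obtain ⟨η, hη, B, hB, hcal⟩ := exists_le_calibratedExcess hp hm
  have hp0 : 0 < p := by linarith
  have hp1 : 0 < p - 1 := by linarith
  have hm0 : 0 < m := by linarith
  set β := m * (p - 1) / p with hβ
  have hβ0 : 0 < β := by positivity
  set D : ℝ := (1 + β) * 2 ^ (1 + β) with hD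
  have hD0 : 0 < D := by positivity
  have hD1 : 1 + β ≤ D := le_mul_of_one_le_right (by positivity)
    (Real.one_le_rpow one_le_two (by positivity))
  refine ⟨η, hη, D * 12 * B, by positivity, fun K L M w h f ρ c hw hh hf hw2 hh0 hhρ hf0 hmin
    hfield => ?_⟩
  set A : Set (EuclideanSpace ℝ (Fin n)) := {x | h x < w x} with hA
  have hAo : IsOpen A := isOpen_lt hh.continuous hw.continuous
  have hsub : A ⊆ ball 0 ρ := fun x hx => by
    rw [mem_ball_zero_iff]
    by_contra hcon
    exact absurd hx (not_lt.2 ((hw2 x).2.trans (hhρ x (not_lt.1 hcon))))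
  have hAfin : volume A ≠ ⊤ := measure_ne_top_of_subset hsub measure_ball_lt_top.ne
  have hh2 : ∀ x ∈ A, h x ∈ Icc (0 : ℝ) 2 := fun x hx => ⟨(hh0 x).le, (le_of_lt hx).trans (hw2 x).2⟩
  let P : EuclideanSpace ℝ (Fin n) → ℝ := fun x =>
    calibratedExcess p m ‖fderiv ℝ w x‖ ‖fderiv ℝ h x‖ (c * f x * fderiv ℝ w x x) (h x) (w x)
      (p * (c * (n * f x + fderiv ℝ f x x)))
  obtain ⟨hQi, hQ⟩ := hw.integrableOn_and_integral_mul_fderiv_sub_add_eq_zero hh hf hf0 hsub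
  have hwi := integrableOn_energyDensity (p := p) hp0 hm0 hw hAo.measurableSet hAfin
    fun x _ => hw2 x
  have hhi := integrableOn_energyDensity (p := p) hp0 hm0 hh hAo.measurableSet hAfin hh2
  have hPeq : ∀ x ∈ A, energyDensity p m w x - energyDensity p m h x - p * c *
      (f x * (fderiv ℝ w x x - fderiv ℝ h x x) + (w x - h x) * (n * f x + fderiv ℝ f x x)) =
      P x := fun x hx => by
    have := (hfield x hx).2.2.2.2
    simp only [P, energyDensity, calibratedExcess]
    linear_combination p * this
  have hPi : IntegrableOn P A :=
    ((hwi.sub hhi).sub (hQi.const_mul (p * c))).congr_fun hPeq hAo.measurableSet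
  have hPint : ∫ x in A, P x ≤ 0 := by
    have hwhi : IntegrableOn (fun x => energyDensity p m w x - energyDensity p m h x) A :=
      hwi.sub hhi
    rw [← setIntegral_congr_fun hAo.measurableSet hPeq, integral_sub hwhi
      (hQi.const_mul _), integral_sub hwi hhi, integral_const_mul, hQ, mul_zero, sub_zero,
      sub_nonpos]
    exact hmin ρ le_rfl L h hh (fun x => (hh0 x).le) hhρ
  let H : EuclideanSpace ℝ (Fin n) → ℝ := {x | 1 / 2 < w x}.indicator fun x => h x ^ (m - 1)
  have hHm : MeasurableSet {x | 1 / 2 < w x} :=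
    measurableSet_lt measurable_const hw.continuous.measurable
  have hH0 : ∀ x, w x ≤ 1 / 2 → H x = 0 := fun x hx =>
    indicator_of_notMem (s := {x | 1 / 2 < w x}) (not_lt.2 hx) _
  have hH1 : ∀ x, 1 / 2 < w x → H x = h x ^ (m - 1) := fun x hx =>
    indicator_of_mem (s := {x | 1 / 2 < w x}) hx _
  have hhmi : IntegrableOn (fun x => h x ^ (m - 1)) A := by
    refine Measure.integrableOn_of_bounded (M := 2 ^ (m - 1)) hAfin ?_
      (ae_restrict_of_forall_mem hAo.measurableSet fun x hx => ?_)
    · exact (hh.continuous.measurable.pow_const _).aestronglyMeasurable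
    · rw [Real.norm_of_nonneg (Real.rpow_nonneg (hh0 x).le _)]
      exact Real.rpow_le_rpow (hh0 x).le (hh2 x hx).2 (by linarith)
  have hHi : IntegrableOn H A := hhmi.indicator hHm
  have hpt : ∀ x ∈ A, (w x ≤ 1 / 2 → 0 ≤ P x) ∧
      (w x ≤ 1 / 2 → 2 * h x < w x → w x ^ β * ‖fderiv ℝ w x‖ + h x ^ β * ‖fderiv ℝ h x‖ ≤
        12 * P x) ∧
      (1 / 2 < w x → h x ^ β * ‖fderiv ℝ h x‖ ≤ 12 * (P x + B * h x ^ (m - 1))) := fun x hx => by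
    obtain ⟨h1, h2, h3, h4, -⟩ := hfield x hx
    refine hcal _ _ _ _ _ _ (norm_nonneg _) (norm_nonneg _) (hh0 x) hx (hw2 x).2 h1 h2 h3 ?_
    rw [abs_mul, ← h4]
    have := (fderiv ℝ w x).le_opNorm x
    rw [Real.norm_eq_abs] at this
    calc _ ≤ |c * f x| * (‖fderiv ℝ w x‖ * ‖x‖) := by gcongr
      _ = _ := by ring
  have hPH : ∀ x ∈ A, 0 ≤ 12 * (P x + B * H x) := fun x hx => by
    obtain ⟨h1, -, h3⟩ := hpt x hx
    rcases le_or_gt (w x) (1 / 2) with hwx | hwx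
    · rw [hH0 x hwx]; linarith [h1 hwx]
    · rw [hH1 x hwx]
      exact le_trans (mul_nonneg (Real.rpow_nonneg (hh0 x).le _) (norm_nonneg _)) (h3 hwx)
  let g : EuclideanSpace ℝ (Fin n) → ℝ := fun x =>
    max (min (w x) (1 / 2) ^ (1 + β) - (2 * h x) ^ (1 + β)) 0
  have hv : LipschitzWith K fun x => min (w x) (1 / 2) := hw.min_const _
  have hv0 : ∀ x, 0 ≤ min (w x) (1 / 2) := fun x => le_min (hw2 x).1 (by norm_num)
  have hzero : ∀ x, min (w x) (1 / 2) ≤ 2 * h x → g x = 0 := fun x hx =>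
    max_eq_right (sub_nonpos.2 (Real.rpow_le_rpow (hv0 x) hx (by positivity)))
  obtain ⟨J, hg⟩ : ∃ J, LipschitzWith J g := by
    refine LocallyLipschitz.exists_lipschitzWith_of_eq_zero (r := ρ) ?_ fun x hx => hzero x
      ((min_le_right _ _).trans (by linarith [hhρ x hx]))
    have hpow : LocallyLipschitz fun s : ℝ => s ^ (1 + β) :=
      (Real.contDiff_rpow_const_of_le (n := 1) (by simpa using hβ0.le)).locallyLipschitz
    have hmul : LipschitzWith 2 fun s : ℝ => 2 * s := by
      refine LipschitzWith.of_dist_le_mul fun s t => ?_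
      rw [Real.dist_eq, Real.dist_eq, ← mul_sub, abs_mul, abs_two, NNReal.coe_ofNat]
    exact ((LipschitzWith.id.max_const (0 : ℝ)).locallyLipschitz.comp
      ((contDiff_fst.sub contDiff_snd : ContDiff ℝ 1 fun p : ℝ × ℝ => p.1 - p.2)
        |>.locallyLipschitz.comp ((hpow.comp hv.locallyLipschitz).prodMk
          (hpow.comp (hmul.comp hh).locallyLipschitz))))
  have hgrad : ∀ᵐ x, ‖fderiv ℝ g x‖ ≤ A.indicator (fun x => D * (12 * (P x + B * H x))) x := by
    filter_upwards [hw.ae_differentiableAt, hh.ae_differentiableAt, hv.ae_differentiableAt,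
      hg.ae_differentiableAt] with x hx1 hx2 hx3 hx4
    rcases le_or_gt (min (w x) (1 / 2)) (2 * h x) with hle | hlt
    · rw [← fderiv_eq_of_le_of_eq (differentiableAt_const 0) hx4 (fun y => le_max_right _ _)
        (hzero x hle).symm]
      simp only [fderiv_fun_const, Pi.zero_apply, norm_zero]
      exact indicator_nonneg (fun x hx => mul_nonneg hD0.le (hPH x hx)) x
    · have hxA : x ∈ A := by
        have := min_le_left (w x) (1 / 2)
        have := hh0 x
        simp only [hA, mem_ofPred_eq]; linarith
      rw [indicator_of_mem hxA]
      obtain ⟨-, h2, h3⟩ := hpt x hxA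
      have hev : g =ᶠ[nhds x] fun y => min (w y) (1 / 2) ^ (1 + β) - (2 * h y) ^ (1 + β) := by
        filter_upwards [(isOpen_lt (hh.continuous.const_mul 2) hv.continuous).mem_nhds hlt]
          with y hy
        refine max_eq_left (sub_nonneg.2 (Real.rpow_le_rpow ?_ (le_of_lt hy) (by positivity)))
        linarith [hh0 y]
      have hd1 := hx3.hasFDerivAt.rpow_const (p := 1 + β) (Or.inr (by linarith))
      have hd2 := (hx2.hasFDerivAt.const_mul 2).rpow_const (p := 1 + β) (Or.inr (by linarith))
      rw [hev.fderiv_eq, (hd1.fun_sub hd2).fderiv, add_sub_cancel_left]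
      have hh' := (hh0 x).le
      have e2 : ‖((1 + β) * (2 * h x) ^ β) • (2 : ℝ) • fderiv ℝ h x‖ =
          D * (h x ^ β * ‖fderiv ℝ h x‖) := by
        rw [norm_smul, norm_smul, Real.norm_of_nonneg (by positivity), Real.norm_two,
          Real.mul_rpow zero_le_two hh', hD, Real.rpow_add two_pos, Real.rpow_one]
        ring
      refine (_root_.norm_sub_le _ _).trans ?_
      rw [e2]
      rcases le_or_gt (w x) (1 / 2) with hwx | hwx
      · have e3 : fderiv ℝ (fun x => min (w x) (1 / 2)) x = fderiv ℝ w x :=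
          fderiv_eq_of_le_of_eq hx3 hx1 (fun y => min_le_left _ _) (min_eq_left hwx)
        have hw0 := (hw2 x).1
        rw [e3, norm_smul, min_eq_left hwx, Real.norm_of_nonneg (by positivity)]
        rw [hH0 x hwx, mul_zero, add_zero]
        rw [min_eq_left hwx] at hlt
        calc _ ≤ D * w x ^ β * ‖fderiv ℝ w x‖ + D * (h x ^ β * ‖fderiv ℝ h x‖) := by gcongr
          _ = D * (w x ^ β * ‖fderiv ℝ w x‖ + h x ^ β * ‖fderiv ℝ h x‖) := by ring
          _ ≤ _ := by gcongr; exact h2 hwx hlt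
      · have e3 : fderiv ℝ (fun x => min (w x) (1 / 2)) x = 0 := by
          rw [fderiv_eq_of_le_of_eq hx3 (differentiableAt_const (1 / 2))
            (fun y => min_le_right _ _) (min_eq_right hwx.le)]
          simp
        rw [e3, smul_zero, norm_zero, zero_add, hH1 x hwx]
        exact mul_le_mul_of_nonneg_left (h3 hwx) hD0.le
  refine ⟨⟨J, hg⟩, ?_⟩
  have hPHi : IntegrableOn (fun x => D * (12 * (P x + B * H x))) A :=
    ((hPi.add (hHi.const_mul B)).const_mul 12).const_mul D
  calc ∫ x, ‖fderiv ℝ g x‖ ≤ ∫ x, A.indicator (fun x => D * (12 * (P x + B * H x))) x :=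
        integral_mono_of_nonneg (Filter.Eventually.of_forall fun _ => norm_nonneg _)
          ((integrable_indicator_iff hAo.measurableSet).2 hPHi) hgrad
    _ = D * (12 * ((∫ x in A, P x) + B * ∫ x in A, H x)) := by
        rw [integral_indicator hAo.measurableSet, integral_const_mul, integral_const_mul,
          integral_add hPi (hHi.const_mul B), integral_const_mul]
    _ ≤ D * (12 * (0 + B * ∫ x in A, H x)) := by gcongr
    _ = _ := by
        rw [setIntegral_indicator hHm]; ring

theorem LocallyLipschitz.rpow_const {X : Type*} [PseudoEMetricSpace X] {f : X → ℝ}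
    (hf : LocallyLipschitz f) (h0 : ∀ x, 0 < f x) (e : ℝ) : LocallyLipschitz fun x => f x ^ e := by
  intro x
  obtain ⟨K, t, ht, hK⟩ := (Real.contDiffAt_rpow_const_of_ne (n := 1) (p := e)
    (h0 x).ne').exists_lipschitzOnWith
  obtain ⟨L, s, hs, hL⟩ := hf x
  refine ⟨K * L, s ∩ f ⁻¹' t, Filter.inter_mem hs (hf.continuous.continuousAt ht), ?_⟩
  exact hK.comp (hL.mono inter_subset_left) fun y hy => hy.2

theorem rpow_one_sub_mul_rpow_sub_one_le_one {q ρ s : ℝ} (hq : 1 < q) (hρ : 0 < ρ) (hs : 0 ≤ s)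
    (hsρ : s ≤ ρ) : ρ ^ (1 - q) * s ^ (q - 1) ≤ 1 := by
  calc _ ≤ ρ ^ (1 - q) * ρ ^ (q - 1) := by
        gcongr
    _ = 1 := by rw [← Real.rpow_add hρ]; simp

theorem exists_calibrated_barrier (n : ℕ) {p m : ℝ} (hp : 1 < p) (hpm : p < m) {η : ℝ}
    (hη : 0 < η) :
    ∃ σ > (1 : ℝ), ∃ K > (0 : ℝ), ∃ C > (0 : ℝ), ∀ ρ > (0 : ℝ),
      ∃ (h f : EuclideanSpace ℝ (Fin n) → ℝ) (c : ℝ),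
        (∃ L, LipschitzWith L h) ∧ (∃ M, LipschitzWith M f) ∧ (∀ x, 0 < h x) ∧
        (∀ x, ρ ≤ ‖x‖ → 2 ≤ h x) ∧ (∀ x, 0 ≤ f x) ∧
        (∀ x, h x < 2 → ‖fderiv ℝ h x‖ ^ p ≤ η * h x ^ m ∧
          0 ≤ p * (c * (n * f x + fderiv ℝ f x x)) ∧
          p * (c * (n * f x + fderiv ℝ f x x)) ≤ η * h x ^ (m - 1) ∧
          |c * f x| * ‖x‖ = ‖fderiv ℝ h x‖ ^ (p - 1) ∧
          c * f x * fderiv ℝ h x x = ‖fderiv ℝ h x‖ ^ p) ∧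
        (∀ x, ‖x‖ ≤ ρ → h x ^ (m - 1) ≤ C * (1 + ρ - ‖x‖) ^ (-σ)) ∧
        (∀ x, ‖x‖ + K ≤ ρ → h x ≤ 1 / 8) := by
  have hp0 : 0 < p := by linarith
  have hp1 : 0 < p - 1 := by linarith
  have hm1 : 0 < m - 1 := by linarith
  have hmp : 0 < m - p := by linarith
  set a : ℝ := p / (m - p) with ha
  have ha0 : 0 < a := by positivity
  have ham : (a + 1) * p = a * m := by rw [ha]; field_simp; ring
  set b : ℝ := (a + 1) * (p - 1) with hb
  have hb0 : 0 < b := by positivity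
  have hσ : b + 1 = a * (m - 1) := by rw [hb]; linear_combination ham
  set q : ℝ := p / (p - 1) with hq
  have hq1 : 1 < q := by rw [hq, lt_div_iff₀ hp1]; linarith
  have hqp : (q - 1) * (p - 1) = 1 := by rw [hq]; field_simp; ring
  have hμ : 0 < min 1 η := lt_min one_pos hη
  set d : ℝ := 2 * a * q / min 1 η + p * (n + b * q) / η + 1 with hd
  have hd0 : 0 < d := by positivity
  have hd1 : 2 * a * q / d ≤ min 1 η := by
    rw [div_le_iff₀ hd0, ← div_le_iff₀' hμ, hd]
    have : 0 ≤ p * (n + b * q) / η := by positivity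
    linarith
  have hd2 : p * (n + b * q) / d ≤ η := by
    rw [div_le_iff₀ hd0, ← div_le_iff₀' hη, hd]
    have : 0 ≤ 2 * a * q / min 1 η := by positivity
    linarith
  refine ⟨b + 1, by linarith, d * 16 ^ a⁻¹, by positivity, 2 ^ (m - 1) * (d + 1) ^ (b + 1),
    by positivity, fun ρ hρ => ?_⟩
  let T : EuclideanSpace ℝ (Fin n) → ℝ := fun x => (ρ - ρ ^ (1 - q) * ‖x‖ ^ q) / d
  let t : EuclideanSpace ℝ (Fin n) → ℝ := fun x => max (T x) 1
  have ht1 : ∀ x, 1 ≤ t x := fun x => le_max_right _ _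
  have ht0 : ∀ x, 0 < t x := fun x => one_pos.trans_le (ht1 x)
  have hT : ∀ x, HasFDerivAt T (-(ρ ^ (1 - q) * (q * ‖x‖ ^ (q - 2)) / d) • innerSL ℝ x) x :=
    fun x => by
      have h1 := ((hasFDerivAt_norm_rpow x hq1).const_mul (ρ ^ (1 - q))).const_sub ρ
        |>.mul_const d⁻¹
      refine h1.congr_fderiv ?_
      rw [smul_neg, smul_smul, smul_smul, ← neg_smul]
      congr 1; ring
  have hTL : LocallyLipschitz T :=
    (((contDiff_const.sub (contDiff_const.mul (contDiff_norm_rpow hq1))).div_const d :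
      ContDiff ℝ 1 T)).locallyLipschitz
  have htL : LocallyLipschitz t := (LipschitzWith.id.max_const (1 : ℝ)).locallyLipschitz.comp hTL
  have hsρ : ∀ x : EuclideanSpace ℝ (Fin n), ‖x‖ ≤ ρ → ρ ^ (1 - q) * ‖x‖ ^ q ≤ ‖x‖ := fun x hx => by
    have h1 := rpow_one_sub_mul_rpow_sub_one_le_one hq1 hρ (norm_nonneg x) hx
    have h2 : ‖x‖ ^ q = ‖x‖ ^ (q - 1) * ‖x‖ := by
      rw [← Real.rpow_add_one' (norm_nonneg x) (by linarith)]; simp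
    rw [h2, ← mul_assoc]
    exact mul_le_of_le_one_left (norm_nonneg x) h1
  have hTge : ∀ x, ‖x‖ ≤ ρ → (ρ - ‖x‖) / d ≤ t x := fun x hx => by
    refine le_trans ?_ (le_max_left _ _)
    simp only [T]
    gcongr
    exact hsρ x hx
  have htρ : ∀ x, ρ ≤ ‖x‖ → t x = 1 := fun x hx => by
    refine max_eq_right ?_
    have h1 : ρ ^ (1 - q) * ρ ^ q = ρ := by rw [← Real.rpow_add hρ]; simp
    have h2 : ρ ^ (1 - q) * ρ ^ q ≤ ρ ^ (1 - q) * ‖x‖ ^ q := by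
      gcongr
    simp only [T]
    rw [div_le_iff₀ hd0]; linarith
  have hLip : ∀ e : ℝ, ∃ L, LipschitzWith L fun x => t x ^ e := fun e => by
    obtain ⟨L, hL⟩ := LocallyLipschitz.exists_lipschitzWith_of_eq_zero (r := ρ)
      (f := fun x => t x ^ e - 1)
      ((LipschitzWith.id.sub (LipschitzWith.const (1 : ℝ))).locallyLipschitz.comp
        (htL.rpow_const ht0 e)) fun x hx => by rw [htρ x hx]; simp
    refine ⟨L + 0, ?_⟩
    have := hL.add (LipschitzWith.const (1 : ℝ))
    simpa using this
  have hh : ∀ x, (2 * t x ^ (-a)) ^ (m - 1) = 2 ^ (m - 1) * t x ^ (-(b + 1)) := fun x => by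
    rw [Real.mul_rpow zero_le_two (Real.rpow_nonneg (ht0 x).le _), ← Real.rpow_mul (ht0 x).le,
      hσ, neg_mul]
  refine ⟨fun x => 2 * t x ^ (-a), fun x => t x ^ (-b), (2 * a * q / d) ^ (p - 1) / ρ, ?_, hLip _,
    fun x => ?_, fun x hx => ?_, fun x => Real.rpow_nonneg (ht0 x).le _, fun x hx => ?_,
    fun x hx => ?_, fun x hx => ?_⟩
  · obtain ⟨L, hL⟩ := hLip (-a)
    refine ⟨2 * L, LipschitzWith.of_dist_le_mul fun x y => ?_⟩
    have := hL.dist_le_mul x y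
    rw [Real.dist_eq] at this ⊢
    rw [← mul_sub, abs_mul, abs_two]
    push_cast
    linarith
  · have := Real.rpow_pos_of_pos (ht0 x) (-a)
    positivity
  · simp [htρ x hx]
  · set τ := t x with hτ
    set s := ‖x‖ with hs
    have hτ0 : 0 < τ := ht0 x
    have hs0 : 0 ≤ s := norm_nonneg x
    have hτ1 : 1 < τ := by
      refine lt_of_le_of_ne (ht1 x) fun h1 => absurd hx ?_
      simp [← hτ, ← h1]
    have hsρ' : s ≤ ρ := by
      by_contra! hcon
      exact absurd (htρ x hcon.le) hτ1.ne'
    have hTx : 1 < T x := by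
      by_contra! hcon
      exact hτ1.ne' (max_eq_right hcon)
    have hτT : τ ≤ ρ / d := by
      have : τ = T x := max_eq_left hTx.le
      rw [this]
      simp only [T]
      gcongr
      have : 0 ≤ ρ ^ (1 - q) * ‖x‖ ^ q := by positivity
      linarith
    have hdt : HasFDerivAt t _ x := (hT x).congr_of_eventuallyEq (by
      filter_upwards [(isOpen_lt continuous_const hTL.continuous).mem_nhds hTx] with y hy
      exact max_eq_left (le_of_lt hy))
    have hdh := (hdt.rpow_const (p := -a) (Or.inl hτ0.ne')).const_mul 2
    have hdf := hdt.rpow_const (p := -b) (Or.inl hτ0.ne')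
    rw [hdh.fderiv, hdf.fderiv, hh, ← hτ, ← hs]
    set κ : ℝ := 2 * a * q / d with hκ
    have hκ0 : 0 < κ := by positivity
    have hκ1 : κ ≤ 1 := hd1.trans (min_le_left _ _)
    have hκη : κ ≤ η := hd1.trans (min_le_right _ _)
    set z : ℝ := κ * ρ ^ (1 - q) * τ ^ (-a - 1) * s ^ (q - 1) with hz
    have hz0 : 0 ≤ z := by positivity
    have hsq : s ^ (q - 2) * s = s ^ (q - 1) := by
      rw [← Real.rpow_add_one' hs0 (by linarith)]; congr 1; ring
    have hsq' : s ^ (q - 1) * s = s ^ q := by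
      rw [← Real.rpow_add_one' hs0 (by linarith)]; congr 1; ring
    have hnorm : ‖(2 : ℝ) • (-a * τ ^ (-a - 1)) • -(ρ ^ (1 - q) * (q * s ^ (q - 2)) / d) •
        innerSL ℝ x‖ = z := by
      rw [smul_smul, smul_smul, show 2 * (-a * τ ^ (-a - 1)) * -(ρ ^ (1 - q) * (q * s ^ (q - 2)) / d)
        = κ * ρ ^ (1 - q) * τ ^ (-a - 1) * s ^ (q - 2) by rw [hκ]; ring, norm_smul,
        innerSL_apply_norm, ← hs, Real.norm_of_nonneg (by positivity), hz, ← hsq]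
      ring
    have happ : ((2 : ℝ) • (-a * τ ^ (-a - 1)) • -(ρ ^ (1 - q) * (q * s ^ (q - 2)) / d) •
        innerSL ℝ x) x = z * s := by
      simp only [smul_apply, innerSL_apply_apply, real_inner_self_eq_norm_sq, smul_eq_mul]
      rw [hz, ← hsq, hκ, ← hs]
      ring
    have hfapp : ((-b * τ ^ (-b - 1)) • -(ρ ^ (1 - q) * (q * s ^ (q - 2)) / d) •
        innerSL ℝ x) x = b * q / d * τ ^ (-b - 1) * (ρ ^ (1 - q) * s ^ q) := by
      simp only [smul_apply, innerSL_apply_apply, real_inner_self_eq_norm_sq, smul_eq_mul]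
      rw [← hsq', ← hsq, ← hs]
      ring
    have hzp : z ^ (p - 1) = κ ^ (p - 1) / ρ * τ ^ (-b) * s := by
      rw [hz, Real.mul_rpow (by positivity) (by positivity),
        Real.mul_rpow (by positivity) (by positivity),
        Real.mul_rpow (by positivity) (by positivity), ← Real.rpow_mul hρ.le,
        ← Real.rpow_mul hτ0.le, ← Real.rpow_mul hs0, hqp, Real.rpow_one,
        show (1 - q) * (p - 1) = -1 by linear_combination -hqp,
        show (-a - 1) * (p - 1) = -b by rw [hb]; ring, Real.rpow_neg_one]
      ring
    have hzz : z ^ (p - 1) * z = z ^ p := by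
      rw [← Real.rpow_add_one' hz0 (by linarith)]; congr 1; ring
    have hτb : τ ^ (-b) = τ ^ (-b - 1) * τ := by
      rw [← Real.rpow_add_one hτ0.ne']; congr 1; ring
    have hκp : κ ^ (p - 1) ≤ 1 := Real.rpow_le_one hκ0.le hκ1 hp1.le
    have h2m : (1 : ℝ) ≤ 2 ^ m := Real.one_le_rpow one_le_two (by linarith)
    have h2m1 : (1 : ℝ) ≤ 2 ^ (m - 1) := Real.one_le_rpow one_le_two hm1.le
    have hfpos : 0 ≤ b * q / d * τ ^ (-b - 1) * (ρ ^ (1 - q) * s ^ q) := by positivity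
    rw [hnorm, happ, hfapp]
    refine ⟨?_, by positivity, ?_, ?_, ?_⟩
    · have h1 : z ≤ κ * τ ^ (-a - 1) := by
        have := rpow_one_sub_mul_rpow_sub_one_le_one hq1 hρ hs0 hsρ'
        calc z = κ * τ ^ (-a - 1) * (ρ ^ (1 - q) * s ^ (q - 1)) := by rw [hz]; ring
          _ ≤ _ := mul_le_of_le_one_right (by positivity) this
      calc z ^ p ≤ (κ * τ ^ (-a - 1)) ^ p := by gcongr
        _ = κ ^ p * τ ^ (-(a * m)) := by
          rw [Real.mul_rpow hκ0.le (by positivity), ← Real.rpow_mul hτ0.le, ← ham]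
          congr 2; ring
        _ ≤ (η * 2 ^ m) * τ ^ (-(a * m)) := by
          gcongr
          calc κ ^ p ≤ κ := Real.rpow_le_self_of_le_one hκ0.le hκ1 hp.le
            _ ≤ η := hκη
            _ ≤ η * 2 ^ m := le_mul_of_one_le_right hη.le h2m
        _ = η * (2 * τ ^ (-a)) ^ m := by
          rw [Real.mul_rpow zero_le_two (by positivity), ← Real.rpow_mul hτ0.le]
          ring_nf
    · have h1 : n * τ ^ (-b) + b * q / d * τ ^ (-b - 1) * (ρ ^ (1 - q) * s ^ q) ≤
          n * (τ ^ (-b - 1) * (ρ / d)) + b * q / d * τ ^ (-b - 1) * ρ := by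
        rw [hτb]
        gcongr
        exact (hsρ x hsρ').trans hsρ'
      calc _ ≤ p * (1 / ρ * (n * (τ ^ (-b - 1) * (ρ / d)) + b * q / d * τ ^ (-b - 1) * ρ)) := by
            gcongr
        _ = p * (n + b * q) / d * τ ^ (-(b + 1)) := by
            rw [show -(b + 1) = -b - 1 by ring]; field_simp
        _ ≤ η * (1 * τ ^ (-(b + 1))) := by
            rw [one_mul]; gcongr
        _ ≤ _ := by gcongr
    · rw [abs_of_nonneg (by positivity), hzp]
    · rw [← hzz, hzp]; ring
  · rw [hh, mul_assoc]
    gcongr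
    have h1 := hTge x hx
    rw [div_le_iff₀ hd0] at h1
    have h2 : 1 + ρ - ‖x‖ ≤ (d + 1) * t x := by linarith [ht1 x]
    have h3 : 0 < 1 + ρ - ‖x‖ := by linarith
    rw [Real.rpow_neg (ht0 x).le, Real.rpow_neg h3.le, inv_le_iff_one_le_mul₀ (by positivity),
      mul_right_comm, ← div_eq_mul_inv, le_div_iff₀ (by positivity), one_mul,
      ← Real.mul_rpow (by positivity) (ht0 x).le]
    gcongr
  · have h1 := hTge x (le_trans (by linarith [show 0 < d * 16 ^ a⁻¹ by positivity]) hx)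
    have h2 : (16 : ℝ) ^ a⁻¹ ≤ t x := by
      refine le_trans ?_ h1
      rw [le_div_iff₀ hd0]; linarith
    have h3 : (16 : ℝ) ≤ t x ^ a := by
      have := Real.rpow_le_rpow (by positivity) h2 ha0.le
      rwa [← Real.rpow_mul (by norm_num), inv_mul_cancel₀ ha0.ne', Real.rpow_one] at this
    have h4 : (t x ^ a)⁻¹ ≤ 16⁻¹ := inv_anti₀ (by norm_num) h3
    show 2 * t x ^ (-a) ≤ 1 / 8
    rw [Real.rpow_neg (ht0 x).le]
    linarith

theorem integrableOn_one_add_sub_norm_rpow {n : ℕ} (ρ : ℝ) {σ : ℝ} (hσ : 0 ≤ σ)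
    {s : Set (EuclideanSpace ℝ (Fin n))} (hs : MeasurableSet s) (hsub : s ⊆ ball 0 ρ) :
    IntegrableOn (fun x => (1 + ρ - ‖x‖) ^ (-σ)) s := by
  refine Measure.integrableOn_of_bounded (M := 1)
    (measure_ne_top_of_subset hsub measure_ball_lt_top.ne) ?_
    (ae_restrict_of_forall_mem hs fun x hx => ?_)
  · exact ((measurable_const.sub measurable_norm).pow_const _).aestronglyMeasurable
  · have h1 : ‖x‖ < ρ := mem_ball_zero_iff.1 (hsub hx)
    have h2 : 1 ≤ 1 + ρ - ‖x‖ := by linarith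
    rw [Real.norm_of_nonneg (Real.rpow_nonneg (by linarith) _)]
    exact Real.rpow_le_one_of_one_le_of_nonpos h2 (by linarith)

theorem MinimizesBelowBarriers.exists_measureReal_pow_le {n : ℕ} (hn : 2 ≤ n) {p m : ℝ}
    (hp : 1 < p) (hpm : p < m) :
    ∃ σ > (1 : ℝ), ∃ A > (0 : ℝ), ∃ C > (0 : ℝ),
      ∀ (K : NNReal) (w : EuclideanSpace ℝ (Fin n) → ℝ), LipschitzWith K w →
        (∀ x, w x ∈ Icc (0 : ℝ) 2) → ∀ ρ > (0 : ℝ), MinimizesBelowBarriers p m ρ w →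
        volume.real ({x | 1 / 2 < w x} ∩ ball 0 (ρ - A)) ^ (n - 1) ≤
          (C * ∫ x in {x | 1 / 2 < w x} ∩ ball 0 ρ, (1 + ρ - ‖x‖) ^ (-σ)) ^ n := by
  obtain ⟨C₀, hC₀, hsob⟩ := LipschitzWith.pow_mul_measureReal_pow_le
    (volume : Measure (EuclideanSpace ℝ (Fin n))) (by simpa using hn)
  rw [finrank_euclideanSpace_fin] at hsob
  obtain ⟨η, hη, C₁, hC₁, htrunc⟩ :=
    exists_integral_norm_fderiv_truncation_le n hp (m := m) (by linarith)
  obtain ⟨σ, hσ, A, hA, C₂, hC₂, hbar⟩ := exists_calibrated_barrier n hp hpm hη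
  have hp0 : 0 < p := by linarith
  have hp1 : 0 < p - 1 := by linarith
  have hm0 : 0 < m := by linarith
  set γ : ℝ := 1 + m * (p - 1) / p with hγ
  have hγ0 : 0 < γ := by positivity
  set c : ℝ := (1 / 2) ^ γ - (1 / 4) ^ γ with hc
  have hc0 : 0 < c := sub_pos.2 (Real.rpow_lt_rpow (by norm_num) (by norm_num) hγ0)
  refine ⟨σ, hσ, A, hA, C₀ * C₁ * C₂ / c, by positivity, fun K w hw hw2 ρ hρ hmin => ?_⟩
  obtain ⟨h, f, e, ⟨L, hL⟩, ⟨M, hM⟩, hh0, hhρ, hf0, hfield, hdecay, hsmall⟩ := hbar ρ hρ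
  obtain ⟨⟨J, hJ⟩, hint⟩ := htrunc K L M w h f ρ e hw hL hM hw2 hh0 hhρ hf0 hmin
    fun x hx => hfield x (hx.trans_le (hw2 x).2)
  set G : EuclideanSpace ℝ (Fin n) → ℝ :=
    fun x => max (min (w x) (1 / 2) ^ γ - (2 * h x) ^ γ) 0 with hG
  have hsupp : HasCompactSupport G := by
    refine HasCompactSupport.of_support_subset_isCompact
      (isCompact_closedBall (0 : EuclideanSpace ℝ (Fin n)) ρ) fun x hx => ?_
    rw [mem_closedBall_zero_iff]
    by_contra! hcon
    refine hx (max_eq_right (sub_nonpos.2 (Real.rpow_le_rpow ?_ ?_ hγ0.le)))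
    · exact le_min (hw2 x).1 (by norm_num)
    · linarith [min_le_right (w x) (1 / 2), hhρ x hcon.le]
  have hmeas : ∀ r, MeasurableSet ({x | 1 / 2 < w x} ∩ ball (0 : EuclideanSpace ℝ (Fin n)) r) :=
    fun r => (isOpen_lt continuous_const hw.continuous).measurableSet.inter measurableSet_ball
  have hlow := hsob J G hJ hsupp c hc0 ({x | 1 / 2 < w x} ∩ ball 0 (ρ - A)) fun x hx => by
    refine le_trans ?_ (le_max_left _ _)
    have h1 : ‖x‖ < ρ - A := mem_ball_zero_iff.1 hx.2
    have h2 : min (w x) (1 / 2) = 1 / 2 := min_eq_right (le_of_lt hx.1)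
    rw [h2, hc]
    gcongr
    · linarith [hh0 x]
    · linarith [hsmall x (by linarith)]
  have hsub : {x | h x < w x} ∩ {x | 1 / 2 < w x} ⊆ {x | 1 / 2 < w x} ∩ ball 0 ρ := fun x hx => by
    refine ⟨hx.2, mem_ball_zero_iff.2 ?_⟩
    by_contra! hcon
    exact absurd hx.1 (not_lt.2 ((hw2 x).2.trans (hhρ x hcon)))
  have hdecayint : IntegrableOn (fun x => C₂ * (1 + ρ - ‖x‖) ^ (-σ))
      ({x | 1 / 2 < w x} ∩ ball 0 ρ) :=
    (integrableOn_one_add_sub_norm_rpow ρ (by linarith) (hmeas ρ) inter_subset_right).const_mul C₂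
  have hmeas' : MeasurableSet ({x | h x < w x} ∩ {x | 1 / 2 < w x}) :=
    (isOpen_lt hL.continuous hw.continuous).measurableSet.inter
      (isOpen_lt continuous_const hw.continuous).measurableSet
  have hup : ∫ x in {x | h x < w x} ∩ {x | 1 / 2 < w x}, h x ^ (m - 1) ≤
      C₂ * ∫ x in {x | 1 / 2 < w x} ∩ ball 0 ρ, (1 + ρ - ‖x‖) ^ (-σ) := by
    calc _ ≤ ∫ x in {x | h x < w x} ∩ {x | 1 / 2 < w x}, C₂ * (1 + ρ - ‖x‖) ^ (-σ) := by
          refine integral_mono_of_nonneg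
            (Filter.Eventually.of_forall fun x => Real.rpow_nonneg (hh0 x).le _)
            (hdecayint.mono_set hsub) (ae_restrict_of_forall_mem hmeas' fun x hx => ?_)
          exact hdecay x (mem_ball_zero_iff.1 (hsub hx).2).le
      _ ≤ ∫ x in {x | 1 / 2 < w x} ∩ ball 0 ρ, C₂ * (1 + ρ - ‖x‖) ^ (-σ) := by
          refine setIntegral_mono_set hdecayint (ae_restrict_of_forall_mem (hmeas ρ) fun x hx => ?_)
            hsub.eventuallyLE
          have : ‖x‖ < ρ := mem_ball_zero_iff.1 hx.2
          exact mul_nonneg hC₂.le (Real.rpow_nonneg (by linarith) _)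
      _ = _ := integral_const_mul _ _
  have hfin : c ^ n * volume.real ({x | 1 / 2 < w x} ∩ ball 0 (ρ - A)) ^ (n - 1) ≤
      (C₀ * (C₁ * (C₂ * ∫ x in {x | 1 / 2 < w x} ∩ ball 0 ρ, (1 + ρ - ‖x‖) ^ (-σ)))) ^ n := by
    refine hlow.trans (pow_le_pow_left₀ (mul_nonneg hC₀.le
      (integral_nonneg fun _ => norm_nonneg _)) ?_ n)
    gcongr
    exact hint.trans (by gcongr)
  rw [show C₀ * C₁ * C₂ / c * (∫ x in {x | 1 / 2 < w x} ∩ ball 0 ρ, (1 + ρ - ‖x‖) ^ (-σ)) =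
    C₀ * (C₁ * (C₂ * ∫ x in {x | 1 / 2 < w x} ∩ ball 0 ρ, (1 + ρ - ‖x‖) ^ (-σ))) / c by ring,
    div_pow, le_div_iff₀ (by positivity), mul_comm]
  exact hfin

theorem add_one_pow_succ_le {x : ℝ} (hx : 0 ≤ x) (d : ℕ) :
    (x + 1) ^ (d + 1) ≤ x ^ (d + 1) + (d + 1) * (x + 1) ^ d := by
  induction d with
  | zero => simp
  | succ d ih =>
    have h1 := mul_le_mul_of_nonneg_left ih hx
    have h2 : 0 ≤ (d + 1) * (x + 1) ^ d := by positivity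
    push_cast
    linear_combination h1 + h2

theorem pow_succ_le_mul_sum_pow (d M : ℕ) :
    (M : ℝ) ^ (d + 1) ≤ (d + 1) * ∑ j ∈ Finset.range (M + 1), (j : ℝ) ^ d := by
  induction M with
  | zero => simpa using by positivity
  | succ M ih =>
    rw [Finset.sum_range_succ]
    have := add_one_pow_succ_le (Nat.cast_nonneg (α := ℝ) M) d
    push_cast
    linarith

theorem pow_le_of_pow_le_mul_of_sum_le {d A : ℕ} (hd : d ≠ 0) (hA : A ≠ 0) {C S c₀ κ : ℝ}
    (hC : 0 < C) (hκ : 0 ≤ κ) (hκc : (2 * A * κ) ^ (d + 1) ≤ c₀)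
    (hκC : κ * (2 ^ (d + 1) * (d + 1) * (C * S)) ≤ 1) {V I : ℕ → ℝ} {N : ℕ} (hV : Monotone V)
    (hV0 : 0 ≤ V 0) (hV1 : c₀ ≤ V 1) (hI : ∀ k, 0 ≤ I k)
    (hstep : ∀ j, j + A ≤ N → V j ^ d ≤ (C * I (j + A)) ^ (d + 1))
    (hsum : ∀ k ≤ N, ∑ j ∈ Finset.range (k + 1), I j ≤ S * V k) :
    (κ * N) ^ (d + 1) ≤ V N := by
  suffices ∀ k ≤ N, (κ * k) ^ (d + 1) ≤ V k from this N le_rfl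
  intro k
  induction k using Nat.strong_induction_on with
  | _ k ih =>
  intro hk
  rcases Nat.eq_zero_or_pos k with rfl | hk0
  · simpa using hV0
  rcases le_or_gt k (2 * A) with hkA | hkA
  · refine le_trans ?_ (hκc.trans (hV1.trans (hV hk0)))
    have : (k : ℝ) ≤ 2 * A := by exact_mod_cast hkA
    rw [mul_comm _ κ]
    gcongr
  obtain ⟨M, rfl⟩ : ∃ M, k = M + A := ⟨k - A, by omega⟩
  have hterm : ∀ j ∈ Finset.range (M + 1), (κ * j) ^ d ≤ C * I (j + A) := fun j hj => by
    have hjM : j ≤ M := by simpa [Nat.lt_succ_iff] using hj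
    have h1 := ih j (by omega) (by omega)
    refine le_of_pow_le_pow_left₀ (n := d + 1) (by omega) (mul_nonneg hC.le (hI _)) ?_
    calc ((κ * j) ^ d) ^ (d + 1) = ((κ * j) ^ (d + 1)) ^ d := by ring
      _ ≤ V j ^ d := by gcongr
      _ ≤ _ := hstep j (by omega)
  have hshift : ∑ j ∈ Finset.range (M + 1), I (j + A) ≤ ∑ j ∈ Finset.range (M + A + 1), I j := by
    rw [show M + A + 1 = A + (M + 1) by ring, Finset.sum_range_add _ A]
    simp only [add_comm A]
    exact le_add_of_nonneg_left (Finset.sum_nonneg fun _ _ => hI _)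
  have h2 : κ ^ d * ∑ j ∈ Finset.range (M + 1), (j : ℝ) ^ d ≤ C * (S * V (M + A)) := by
    calc _ = ∑ j ∈ Finset.range (M + 1), (κ * j) ^ d := by
          rw [Finset.mul_sum]; simp only [mul_pow]
      _ ≤ ∑ j ∈ Finset.range (M + 1), C * I (j + A) := Finset.sum_le_sum hterm
      _ = C * ∑ j ∈ Finset.range (M + 1), I (j + A) := (Finset.mul_sum _ _ _).symm
      _ ≤ _ := by
        gcongr
        exact hshift.trans (hsum _ hk)
  have h3 : ((M + A : ℕ) : ℝ) ≤ 2 * M := by exact_mod_cast (by omega : M + A ≤ 2 * M)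
  have h4 : ((M + A : ℕ) : ℝ) ^ (d + 1) ≤ 2 ^ (d + 1) * ((d + 1) *
      ∑ j ∈ Finset.range (M + 1), (j : ℝ) ^ d) := by
    calc _ ≤ (2 * M : ℝ) ^ (d + 1) := by gcongr
      _ ≤ _ := by rw [mul_pow]; gcongr; exact pow_succ_le_mul_sum_pow d M
  have hVk : 0 ≤ V (M + A) := hV0.trans (hV (Nat.zero_le _))
  calc _ = κ * (κ ^ d * ((M + A : ℕ) : ℝ) ^ (d + 1)) := by ring
    _ ≤ κ * (κ ^ d * (2 ^ (d + 1) * ((d + 1) * ∑ j ∈ Finset.range (M + 1), (j : ℝ) ^ d))) := by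
        gcongr
    _ = κ * (2 ^ (d + 1) * (d + 1) * (κ ^ d * ∑ j ∈ Finset.range (M + 1), (j : ℝ) ^ d)) := by ring
    _ ≤ κ * (2 ^ (d + 1) * (d + 1) * (C * (S * V (M + A)))) := by gcongr
    _ = κ * (2 ^ (d + 1) * (d + 1) * (C * S)) * V (M + A) := by ring
    _ ≤ V (M + A) := mul_le_of_le_one_left hVk hκC

theorem sum_indicator_one_add_sub_rpow_le {σ : ℝ} (hσ : 1 < σ) (N : ℕ) (r : ℝ) :
    ∑ k ∈ Finset.range (N + 1), (Ioi r).indicator (fun y => (1 + y - r) ^ (-σ)) (k : ℝ) ≤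
      ∑' j : ℕ, ((j : ℝ) + 1) ^ (-σ) := by
  have hsum : Summable fun j : ℕ => ((j : ℝ) + 1) ^ (-σ) := by
    have := (summable_nat_add_iff 1).2 (Real.summable_nat_rpow.2 (by linarith : -σ < -1))
    simpa using this
  set c := ⌈r⌉₊ with hc
  have hrc : r ≤ c := Nat.le_ceil r
  have hzero : ∀ k ∈ Finset.range (N + 1), k ∉ Finset.Ico c (N + 1) →
      (Ioi r).indicator (fun y => (1 + y - r) ^ (-σ)) (k : ℝ) = 0 := fun k hk hk' => by
    refine indicator_of_notMem (fun h => hk' ?_) _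
    rw [Finset.mem_Ico]
    exact ⟨Nat.ceil_le.2 (le_of_lt h), Finset.mem_range.1 hk⟩
  rw [← Finset.sum_subset (fun k hk => by simp at hk ⊢; omega) hzero,
    Finset.sum_Ico_eq_sum_range]
  refine le_trans (Finset.sum_le_sum fun j _ => ?_)
    (hsum.sum_le_tsum (Finset.range (N + 1 - c)) fun j _ => by positivity)
  rw [indicator_apply]
  split_ifs
  · refine Real.rpow_le_rpow_of_nonpos (by positivity) ?_ (by linarith)
    push_cast; linarith
  · positivity

theorem sum_setIntegral_one_add_sub_norm_rpow_le {n : ℕ} {σ : ℝ} (hσ : 1 < σ)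
    {E : Set (EuclideanSpace ℝ (Fin n))} (hE : MeasurableSet E) (N : ℕ) :
    ∑ k ∈ Finset.range (N + 1), ∫ x in E ∩ ball 0 (k : ℝ), (1 + (k : ℝ) - ‖x‖) ^ (-σ) ≤
      (∑' j : ℕ, ((j : ℝ) + 1) ^ (-σ)) * volume.real (E ∩ ball 0 (N : ℝ)) := by
  have hm : ∀ k : ℕ, MeasurableSet (E ∩ ball (0 : EuclideanSpace ℝ (Fin n)) (k : ℝ)) :=
    fun k => hE.inter measurableSet_ball
  have hterm : ∀ k ∈ Finset.range (N + 1),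
      ∫ x in E ∩ ball 0 (k : ℝ), (1 + (k : ℝ) - ‖x‖) ^ (-σ) =
      ∫ x in E ∩ ball 0 (N : ℝ), (ball 0 (k : ℝ)).indicator
        (fun x => (1 + (k : ℝ) - ‖x‖) ^ (-σ)) x := fun k hk => by
    have hkN : (k : ℝ) ≤ N := by exact_mod_cast Nat.lt_succ_iff.1 (Finset.mem_range.1 hk)
    rw [setIntegral_indicator measurableSet_ball, inter_assoc,
      inter_eq_self_of_subset_right (ball_subset_ball hkN)]
  rw [Finset.sum_congr rfl hterm, ← integral_finsetSum]
  · have hfin : volume (E ∩ ball (0 : EuclideanSpace ℝ (Fin n)) (N : ℝ)) ≠ ⊤ :=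
      measure_ne_top_of_subset inter_subset_right measure_ball_lt_top.ne
    calc _ ≤ ∫ _ in E ∩ ball (0 : EuclideanSpace ℝ (Fin n)) (N : ℝ),
          ∑' j : ℕ, ((j : ℝ) + 1) ^ (-σ) := by
          refine integral_mono_of_nonneg (Filter.Eventually.of_forall fun x => ?_)
            (integrableOn_const hfin) (Filter.Eventually.of_forall fun x => ?_)
          · refine Finset.sum_nonneg fun k _ => indicator_nonneg (fun y hy => ?_) x
            have := mem_ball_zero_iff.1 hy
            exact Real.rpow_nonneg (by linarith) _
          · refine le_trans (le_of_eq (Finset.sum_congr rfl fun k _ => ?_))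
              (sum_indicator_one_add_sub_rpow_le hσ N ‖x‖)
            simp [indicator]
      _ = _ := by rw [setIntegral_const, smul_eq_mul, mul_comm]
  · intro k hk
    rw [integrable_indicator_iff measurableSet_ball]
    have := integrableOn_one_add_sub_norm_rpow (k : ℝ) (by linarith : 0 ≤ σ) (hm k)
      inter_subset_right
    rw [IntegrableOn, Measure.restrict_restrict measurableSet_ball]
    refine IntegrableOn.mono_set this fun x hx => ⟨hx.2.1, hx.1⟩

theorem MinimizesBelowBarriers.exists_mul_pow_le_measureReal {n : ℕ} (hn : 2 ≤ n) {p m : ℝ}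
    (hp : 1 < p) (hpm : p < m) :
    ∃ κ > (0 : ℝ), ∀ (K : NNReal) (w : EuclideanSpace ℝ (Fin n) → ℝ), LipschitzWith K w →
      (∀ x, w x ∈ Icc (0 : ℝ) 2) → ∀ N : ℕ, 1 ≤ N → MinimizesBelowBarriers p m N w → w 0 = 1 →
      (κ * N) ^ n ≤ volume.real ({x | 1 / 2 < w x} ∩ ball 0 (N : ℝ)) := by
  obtain ⟨c₀, hc₀, hbase⟩ :=
    MinimizesBelowBarriers.exists_le_measureReal hn hp (m := m) (by linarith)
  obtain ⟨σ, hσ, A, hA, C, hC, hstep⟩ := MinimizesBelowBarriers.exists_measureReal_pow_le hn hp hpm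
  obtain ⟨d, rfl⟩ : ∃ d, n = d + 1 := ⟨n - 1, by omega⟩
  set A' := ⌈A⌉₊ with hA'
  have hA'0 : 0 < A' := Nat.ceil_pos.2 hA
  have hAA' : A ≤ A' := Nat.le_ceil A
  set S : ℝ := ∑' j : ℕ, ((j : ℝ) + 1) ^ (-σ) with hS
  have hS0 : 0 < S := by
    have hsum : Summable fun j : ℕ => ((j : ℝ) + 1) ^ (-σ) := by
      have := (summable_nat_add_iff 1).2 (Real.summable_nat_rpow.2 (by linarith : -σ < -1))
      simpa using this
    exact hsum.tsum_pos (fun j => by positivity) 0 (by simp)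
  set κ : ℝ := min (min c₀ 1 / (2 * A')) (2 ^ (d + 1) * (d + 1) * (C * S))⁻¹ with hκ
  have hA'r : (0 : ℝ) < A' := by exact_mod_cast hA'0
  have hκ0 : 0 < κ := lt_min (by positivity) (by positivity)
  refine ⟨κ, hκ0, fun K w hw hw2 N hN hmin hw0 => ?_⟩
  have hE : MeasurableSet {x | 1 / 2 < w x} :=
    (isOpen_lt continuous_const hw.continuous).measurableSet
  have hN1 : (1 : ℝ) ≤ N := by exact_mod_cast hN
  refine pow_le_of_pow_le_mul_of_sum_le (d := d) (A := A') (N := N) (C := C) (S := S) (c₀ := c₀)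
    (V := fun k : ℕ => volume.real ({x | 1 / 2 < w x} ∩ ball 0 (k : ℝ)))
    (I := fun k : ℕ => ∫ x in {x | 1 / 2 < w x} ∩ ball 0 (k : ℝ), (1 + (k : ℝ) - ‖x‖) ^ (-σ))
    (by omega) hA'0.ne' hC hκ0.le ?_ ?_ ?_ measureReal_nonneg ?_ ?_ ?_ ?_
  · have h1 : 2 * A' * κ ≤ min c₀ 1 := by
      rw [mul_comm, ← le_div_iff₀ (by positivity)]
      exact min_le_left _ _
    calc _ ≤ (min c₀ 1) ^ (d + 1) := by gcongr
      _ ≤ min c₀ 1 := pow_le_of_le_one (by positivity) (min_le_right _ _) (by omega)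
      _ ≤ c₀ := min_le_left _ _
  · rw [← le_div_iff₀ (by positivity), one_div]
    exact min_le_right _ _
  · intro i j hij
    exact measureReal_mono (inter_subset_inter_right _ (ball_subset_ball (by exact_mod_cast hij)))
      (measure_ne_top_of_subset inter_subset_right measure_ball_lt_top.ne)
  · simpa using hbase K w hw hw2 (hmin.mono hN1) hw0
  · intro k
    refine setIntegral_nonneg (hE.inter measurableSet_ball) fun x hx => ?_
    have := mem_ball_zero_iff.1 hx.2
    exact Real.rpow_nonneg (by linarith) _
  · intro j hj
    have h1 := hstep K w hw hw2 ((j + A' : ℕ) : ℝ) (by positivity)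
      (hmin.mono (by exact_mod_cast hj))
    refine le_trans (pow_le_pow_left₀ measureReal_nonneg (measureReal_mono
      (inter_subset_inter_right _ (ball_subset_ball ?_))
      (measure_ne_top_of_subset inter_subset_right measure_ball_lt_top.ne)) _) h1
    push_cast
    linarith
  · intro k _
    exact sum_setIntegral_one_add_sub_norm_rpow_le hσ hE k

theorem IsMinOfJpm.exists_mul_pow_le_measureReal {n : ℕ} (hn : 2 ≤ n) {p m : ℝ} (hp : 1 < p)
    (hpm : p < m) :
    ∃ δ > (0 : ℝ), ∃ R₀ > (0 : ℝ), ∀ (Ω : Set (EuclideanSpace ℝ (Fin n)))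
      (u : EuclideanSpace ℝ (Fin n) → ℝ), (∀ x, u x ∈ Icc (-1 : ℝ) 1) → LocLipOn Ω u →
      IsMinOfJpm p m Ω u → u 0 = 0 → ∀ R : ℝ, R₀ ≤ R → ball 0 R ⊆ Ω →
      ENNReal.ofReal (δ * R ^ n) ≤ volume (ball 0 R ∩ {x | 0 ≤ u x}) := by
  obtain ⟨κ, hκ, hgrow⟩ := MinimizesBelowBarriers.exists_mul_pow_le_measureReal hn hp hpm
  obtain ⟨C, hC, hlayer⟩ :=
    MinimizesBelowBarriers.exists_measureReal_le n hp (m := m) (by linarith)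
  obtain ⟨d, rfl⟩ : ∃ d, n = d + 1 := ⟨n - 1, by omega⟩
  refine ⟨κ ^ (d + 1) / 2 / 2 ^ (d + 1), by positivity, 4 * C / κ ^ (d + 1) + 6, by positivity,
    fun Ω u hu hL hmin hu0 R hR hball => ?_⟩
  have hR6 : 6 ≤ R := le_trans (by linarith [show 0 < 4 * C / κ ^ (d + 1) by positivity]) hR
  obtain ⟨N, hN⟩ : ∃ N : ℕ, N = ⌊R⌋₊ - 2 := ⟨_, rfl⟩
  have hfl : 6 ≤ ⌊R⌋₊ := Nat.le_floor (by exact_mod_cast hR6)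
  have hfloor : ((N + 2 : ℕ) : ℝ) ≤ R :=
    (by rw [hN]; congr 1; omega : ((N + 2 : ℕ) : ℝ) = (⌊R⌋₊ : ℝ)) ▸ Nat.floor_le (by linarith)
  have hfloor' : R < N + 3 := by
    have h1 := Nat.lt_floor_add_one R
    have h2 : (⌊R⌋₊ : ℝ) = N + 2 := by exact_mod_cast (by omega : ⌊R⌋₊ = N + 2)
    linarith
  push_cast at hfloor
  have hN1 : 1 ≤ N := by omega
  have hNR : R / 2 ≤ N := by linarith
  have hN0 : (0 : ℝ) < N := by linarith
  have hclosed : closedBall 0 ((N : ℝ) + 1) ⊆ Ω :=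
    (closedBall_subset_ball (by linarith)).trans hball
  obtain ⟨K, w, hw, hw2, hwu, hwmin⟩ := hmin.exists_lipschitz (by linarith) (by linarith) hu hL
    hclosed
  have hbig := hgrow K w hw hw2 N hN1 (hwmin.mono (by linarith)) (by
    rw [hwu 0 (by simp; linarith), hu0, add_zero])
  have hsmall := hlayer K w hw hw2 N (by exact_mod_cast hN1) hwmin
  have hcover : {x | 1 / 2 < w x} ∩ ball 0 (N : ℝ) ⊆
      ({x | 1 / 2 < w x ∧ w x < 1} ∩ ball 0 (N : ℝ)) ∪ (ball 0 R ∩ {x | 0 ≤ u x}) :=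
      fun x hx => by
    have hxN : ‖x‖ < N := mem_ball_zero_iff.1 hx.2
    rcases lt_or_ge (w x) 1 with h | h
    · exact Or.inl ⟨⟨hx.1, h⟩, hx.2⟩
    · refine Or.inr ⟨mem_ball_zero_iff.2 (by linarith), ?_⟩
      have := hwu x (by linarith)
      show 0 ≤ u x
      linarith
  have hfin : volume (ball (0 : EuclideanSpace ℝ (Fin (d + 1))) R ∩ {x | 0 ≤ u x}) ≠ ⊤ :=
    measure_ne_top_of_subset inter_subset_left measure_ball_lt_top.ne
  have hle := (measureReal_mono hcover (measure_union_ne_top (measure_ne_top_of_subset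
    inter_subset_right measure_ball_lt_top.ne) hfin)).trans (measureReal_union_le _ _)
  rw [← ofReal_measureReal hfin]
  refine ENNReal.ofReal_le_ofReal ?_
  have hCN : C * (N : ℝ) ^ d ≤ κ ^ (d + 1) / 2 * (N : ℝ) ^ (d + 1) := by
    have h1 : 4 * C / κ ^ (d + 1) ≤ 2 * N := by linarith
    rw [div_le_iff₀ (by positivity)] at h1
    have h2 : C ≤ κ ^ (d + 1) / 2 * N := by linarith
    calc _ ≤ κ ^ (d + 1) / 2 * N * (N : ℝ) ^ d := by gcongr
      _ = _ := by ring
  rw [Nat.add_sub_cancel] at hsmall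
  rw [mul_pow] at hbig
  calc κ ^ (d + 1) / 2 / 2 ^ (d + 1) * R ^ (d + 1) = κ ^ (d + 1) / 2 * (R / 2) ^ (d + 1) := by
        rw [div_pow]; ring
    _ ≤ κ ^ (d + 1) / 2 * (N : ℝ) ^ (d + 1) := by gcongr
    _ ≤ _ := by linarith

/-- Density estimates for minimizers vanishing at the origin
(Theorem 1.3 in the paper). -/
theorem density_estimate_minimizers
    (n : ℕ) (hn : 2 ≤ n) (p m : ℝ) (hp : 1 < p) (hpm : p < m) :
    ∃ δ > (0 : ℝ), ∃ R₀ > (0 : ℝ),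
      ∀ Ω : Set (EuclideanSpace ℝ (Fin n)), IsOpen Ω →
        (0 : EuclideanSpace ℝ (Fin n)) ∈ Ω →
      ∀ u : EuclideanSpace ℝ (Fin n) → ℝ,
        (∀ x, u x ∈ Icc (-1 : ℝ) 1) → LocLipOn Ω u → IsMinOfJpm p m Ω u →
        u 0 = 0 →
        ∀ R : ℝ, R₀ ≤ R → ball (0 : EuclideanSpace ℝ (Fin n)) R ⊆ Ω →
          ENNReal.ofReal (δ * R ^ n) ≤ volume (ball (0 : EuclideanSpace ℝ (Fin n)) R ∩ {x | 0 ≤ u x}) ∧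
          ENNReal.ofReal (δ * R ^ n) ≤ volume (ball (0 : EuclideanSpace ℝ (Fin n)) R ∩ {x | u x ≤ 0}) := by
  have hm : 0 < m := by linarith
  obtain ⟨δ, hδ, R₀, hR₀, h⟩ := IsMinOfJpm.exists_mul_pow_le_measureReal hn hp hpm
  refine ⟨δ, hδ, R₀, hR₀, fun Ω _ _ u hu hL hmin hu0 R hR hball =>
    ⟨h Ω u hu hL hmin hu0 R hR hball, ?_⟩⟩
  have hneg := h Ω (fun x => -u x) (fun x => ⟨by linarith [(hu x).2], by linarith [(hu x).1]⟩)
    (fun x hx => ?_) hmin.neg (by simp [hu0]) R hR hball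
  · simpa using hneg
  · obtain ⟨K, U, hU, hK⟩ := hL x hx
    exact ⟨K, U, hU, hK.neg⟩
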